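/- Let E be a finite-dimensional real inner product space, K ⊆ E a proper cone with nonempty interior, and F a ν-logarithmically homogeneous self-concordant barrier for K (F three times continuously differentiable and self-concordant on int K, with positive definite Hessians, F(τx) = F(x) − ν·ln τ for τ > 0, and F(xᵢ) → +∞ along sequences in int K converging to boundary points). Let F*(s) := sup_{x ∈ int K}( −⟨s,x⟩ − F(x) ) be its conjugate barrier, assumed finite, three times continuously differentiable and self-concordant with positive definite Hessians on the interior of the dual cone K*. Let A : E → ℝ^m be linear, b ∈ ℝ^m, c ∈ E, β ∈ (0,1), t > 0, s̄ ∈ int K*, and set x̄ := −(1/t)∇F*(s̄) ∈ int K and w̄ := √t·x̄. Suppose x̂ ∈ int K, ŷ ∈ ℝ^m, ŝ ∈ int K* satisfy A x̂ = b, ŝ + A*ŷ = c, ŝ = ∇²F(w̄) x̂, ‖x̂ − x̄‖_{x̄} ≤ β, and ‖ŝ − s̄‖_{s̄} ≤ β. Let (Δx, Δy, Δs) solve Δs + ∇²F(w̄)Δx = −ŝ, AΔx = 0, Δs + A*Δy = 0, and set c_β := (√ν + β)/(1 − β) and Ω(x,s) := ν·ln⟨s,x⟩ + F(x) + F*(s)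 + ν − ν·ln ν. Then for every α ∈ [0,1) with α·c_β < 1, the point (x̂ + αΔx, ŝ + αΔs) satisfies x̂ + αΔx ∈ int K, ŝ + αΔs ∈ int K*, and Ω(x̂ + αΔx, ŝ + αΔs) ≤ Ω(x̂, ŝ) + α·c_β·β² + ω_*(α c_β) − ν·ω_*(α) ≤ Ω(x̂, ŝ) − ln(1 − α c_β), where ω_*(τ) = −τ − ln(1 − τ). -/

import Mathlib

open scoped RealInnerProductSpace

/-- The Hessian of `f` at `x`, as a linear operator on `E` (with respect to the inner product):
the Fréchet derivative of the gradient. -/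
noncomputable def hessOp {E : Type*} [NormedAddCommGroup E] [InnerProductSpace ℝ E]
    [CompleteSpace E] (f : E → ℝ) (x : E) : E →L[ℝ] E :=
  fderiv ℝ (gradient f) x

/-- `f` is self-concordant on the open convex set `D`. -/
def SelfConcordantOn {E : Type*} [NormedAddCommGroup E] [InnerProductSpace ℝ E]
    (f : E → ℝ) (D : Set E) : Prop :=
  IsOpen D ∧ Convex ℝ D ∧ ContDiffOn ℝ 3 f D ∧
    ∀ x ∈ D, ∀ h : E,
      iteratedFDeriv ℝ 3 f x (fun _ => h) ≤
        2 * (iteratedFDeriv ℝ 2 f x (fun _ => h)) ^ ((3 : ℝ) / 2)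

/-- The dual cone of a set `K`. -/
def dualCone {E : Type*} [NormedAddCommGroup E] [InnerProductSpace ℝ E] (K : Set E) : Set E :=
  {s : E | ∀ x ∈ K, 0 ≤ ⟪s, x⟫}

/-- `ω_*(τ) = -τ - ln(1 - τ)`. -/
noncomputable def omegaStar (τ : ℝ) : ℝ := -τ - Real.log (1 - τ)

/-- The functional proximity measure
`Ω(x, s) = ν ln⟨s,x⟩ + F(x) + F*(s) + ν - ν ln ν`. -/
noncomputable def proxOmega {E : Type*} [NormedAddCommGroup E] [InnerProductSpace ℝ E]
    (F Fstar : E → ℝ) (ν : ℝ) (x s : E) : ℝ :=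
  ν * Real.log ⟪s, x⟫ + F x + Fstar s + ν - ν * Real.log ν

section Trilinear

theorem sq_add_sq_le_of_cubic_le {a b c d M : ℝ}
    (h : ∀ x y : ℝ, x ^ 2 + y ^ 2 = 1 →
      a * x ^ 3 + 3 * b * (x ^ 2 * y) + 3 * c * (x * y ^ 2) + d * y ^ 3 ≤ M) :
    √(a ^ 2 + b ^ 2) ≤ M := by
  set z : ℂ := ⟨a, b⟩ with hz
  have hnorm : ‖z‖ = √(a ^ 2 + b ^ 2) := by
    rw [Complex.norm_def, Complex.normSq_apply, hz]
    congr 1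
    ring
  set ρ := ‖z‖ with hρ
  set θ := z.arg / 3 with hθ
  have ha : ρ * Real.cos (3 * θ) = a := by
    rw [show 3 * θ = z.arg by rw [hθ]; ring]
    exact Complex.norm_mul_cos_arg z
  have hb : ρ * Real.sin (3 * θ) = b := by
    rw [show 3 * θ = z.arg by rw [hθ]; ring]
    exact Complex.norm_mul_sin_arg z
  rw [← hnorm]
  rw [Real.cos_three_mul] at ha
  rw [Real.sin_three_mul] at hb
  have hcs := Real.sin_sq_add_cos_sq θ
  set x := Real.cos θ
  set y := Real.sin θ
  obtain ⟨r, hr⟩ : ∃ r : ℝ, r ^ 2 = 3 := ⟨√3, Real.sq_sqrt (by norm_num)⟩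
  have h0 := h x y (by linarith)
  have h1 := h (-x / 2 - r / 2 * y) (-y / 2 + r / 2 * x) (by linear_combination hcs + (x^2+y^2)/4 * hr)
  have h2 := h (-x / 2 + r / 2 * y) (-y / 2 - r / 2 * x) (by linear_combination hcs + (x^2+y^2)/4 * hr)
  have hy : y ^ 2 = 1 - x ^ 2 := by linarith
  have e0 := mul_le_mul_of_nonneg_left h0 (show 0 ≤ (4 * x ^ 2 - 1) ^ 2 / 9 by positivity)
  have e1 := mul_le_mul_of_nonneg_left h1
    (show 0 ≤ (4 * (-x / 2 - r / 2 * y) ^ 2 - 1) ^ 2 / 9 by positivity)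
  have e2 := mul_le_mul_of_nonneg_left h2
    (show 0 ≤ (4 * (-x / 2 + r / 2 * y) ^ 2 - 1) ^ 2 / 9 by positivity)
  have w : (4 * x ^ 2 - 1) ^ 2 / 9 + (4 * (-x / 2 - r / 2 * y) ^ 2 - 1) ^ 2 / 9
    + (4 * (-x / 2 + r / 2 * y) ^ 2 - 1) ^ 2 / 9 = 1 := by grind
  have m0 : (4 * x ^ 2 - 1) ^ 2 / 9 * x ^ 3
    + (4 * (-x / 2 - r / 2 * y) ^ 2 - 1) ^ 2 / 9 * (-x / 2 - r / 2 * y) ^ 3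
    + (4 * (-x / 2 + r / 2 * y) ^ 2 - 1) ^ 2 / 9 * (-x / 2 + r / 2 * y) ^ 3
    = 4 * x ^ 3 - 3 * x := by grind
  have m1 : (4 * x ^ 2 - 1) ^ 2 / 9 * (x ^ 2 * y)
    + (4 * (-x / 2 - r / 2 * y) ^ 2 - 1) ^ 2 / 9 *
      ((-x / 2 - r / 2 * y) ^ 2 * (-y / 2 + r / 2 * x))
    + (4 * (-x / 2 + r / 2 * y) ^ 2 - 1) ^ 2 / 9 *
      ((-x / 2 + r / 2 * y) ^ 2 * (-y / 2 - r / 2 * x))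
    = (3 * y - 4 * y ^ 3) / 3 := by grind
  have m2 : (4 * x ^ 2 - 1) ^ 2 / 9 * (x * y ^ 2)
    + (4 * (-x / 2 - r / 2 * y) ^ 2 - 1) ^ 2 / 9 *
      ((-x / 2 - r / 2 * y) * (-y / 2 + r / 2 * x) ^ 2)
    + (4 * (-x / 2 + r / 2 * y) ^ 2 - 1) ^ 2 / 9 *
      ((-x / 2 + r / 2 * y) * (-y / 2 - r / 2 * x) ^ 2) = 0 := by grind
  have m3 : (4 * x ^ 2 - 1) ^ 2 / 9 * y ^ 3
    + (4 * (-x / 2 - r / 2 * y) ^ 2 - 1) ^ 2 / 9 * (-y / 2 + r / 2 * x) ^ 3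
    + (4 * (-x / 2 + r / 2 * y) ^ 2 - 1) ^ 2 / 9 * (-y / 2 - r / 2 * x) ^ 3 = 0 := by grind
  have hunit : (4 * x ^ 3 - 3 * x) ^ 2 + (3 * y - 4 * y ^ 3) ^ 2 = 1 := by grind
  have key : a * (4 * x ^ 3 - 3 * x) + b * (3 * y - 4 * y ^ 3) = ρ := by
    linear_combination ρ * hunit - (4 * x ^ 3 - 3 * x) * ha - (3 * y - 4 * y ^ 3) * hb
  linear_combination e0 + e1 + e2 + M * w - a * m0 - 3 * b * m1 - 3 * c * m2 - d * m3 - key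

variable {E : Type*} [NormedAddCommGroup E] [InnerProductSpace ℝ E]

theorem exists_orthonormal_decomposition {Q : E →L[ℝ] E} (hQs : ∀ u v, ⟪Q u, v⟫ = ⟪Q v, u⟫)
    (hQ : ∀ u, u ≠ 0 → 0 < ⟪Q u, u⟫) {e : E} (he : ⟪Q e, e⟫ = 1) (u : E) :
    ∃ (e' : E) (a b : ℝ), ⟪Q e, e'⟫ = 0 ∧ ⟪Q e', e'⟫ ≤ 1 ∧ u = a • e + b • e' ∧
      ⟪Q u, u⟫ = a ^ 2 + b ^ 2 := by
  set a := ⟪Q e, u⟫ with ha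
  set w := u - a • e with hw
  have hew : ⟪Q e, w⟫ = 0 := by
    rw [hw, inner_sub_right, inner_smul_right, he, ha]; ring
  have huw : ⟪Q u, u⟫ = a ^ 2 + ⟪Q w, w⟫ := by
    have h1 : u = a • e + w := by rw [hw]; abel
    have h2 : ⟪Q w, e⟫ = 0 := by rw [hQs, hew]
    rw [h1]
    simp only [map_add, map_smul, inner_add_left, inner_add_right, real_inner_smul_left,
      real_inner_smul_right, he, hew, h2]
    ring
  by_cases hw0 : w = 0
  · refine ⟨0, a, 0, by simp, by simp, ?_, ?_⟩
    · rw [hw, sub_eq_zero] at hw0; simpa using hw0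
    · simpa [hw0] using huw
  · have hpos := hQ w hw0
    set b := √⟪Q w, w⟫ with hb
    have hb0 : 0 < b := Real.sqrt_pos.2 hpos
    have hb2 : b ^ 2 = ⟪Q w, w⟫ := Real.sq_sqrt hpos.le
    refine ⟨b⁻¹ • w, a, b, ?_, ?_, ?_, ?_⟩
    · rw [inner_smul_right, hew, mul_zero]
    · rw [map_smul, real_inner_smul_left, real_inner_smul_right, ← hb2]
      apply le_of_eq; field_simp
    · rw [smul_inv_smul₀ hb0.ne', hw]; abel
    · rw [huw, hb2]

/-- A symmetric trilinear form bounded by `2` on the diagonal of the unit sphere of a Euclidean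
norm is bounded by `2` on pairs of unit vectors. -/
theorem inner_trilinear_le {Q : E →L[ℝ] E} (hQs : ∀ u v, ⟪Q u, v⟫ = ⟪Q v, u⟫)
    (hQ : ∀ u, u ≠ 0 → 0 < ⟪Q u, u⟫) {T : E →L[ℝ] E →L[ℝ] E}
    (hT₁ : ∀ u v, T u v = T v u) (hT₂ : ∀ u v w, ⟪T u v, w⟫ = ⟪T u w, v⟫)
    (hT : ∀ h, ⟪T h h, h⟫ ≤ 2 * √⟪Q h, h⟫ ^ 3) (h u : E) :
    ⟪T h h, u⟫ ≤ 2 * ⟪Q h, h⟫ * √⟪Q u, u⟫ := by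
  by_cases hh : h = 0
  · simp [hh]
  have hpos := hQ h hh
  set r := √⟪Q h, h⟫ with hr
  have hr0 : 0 < r := Real.sqrt_pos.2 hpos
  have hr2 : r ^ 2 = ⟪Q h, h⟫ := Real.sq_sqrt hpos.le
  set e := r⁻¹ • h with he
  have hhe : h = r • e := by rw [he, smul_inv_smul₀ hr0.ne']
  have he1 : ⟪Q e, e⟫ = 1 := by
    rw [he, map_smul, real_inner_smul_left, real_inner_smul_right, ← hr2]
    field_simp
  clear_value e
  obtain ⟨e', a, b, h0, h1, hu, hQu⟩ := exists_orthonormal_decomposition hQs hQ he1 u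
  have hcubic := sq_add_sq_le_of_cubic_le (a := ⟪T e e, e⟫) (b := ⟪T e e, e'⟫)
    (c := ⟪T e e', e'⟫) (d := ⟪T e' e', e'⟫) (M := 2) (by
      intro x y hxy
      have h2 := hT (x • e + y • e')
      have h0' : ⟪Q e', e⟫ = 0 := by rw [hQs, h0]
      have h3 : ⟪Q (x • e + y • e'), x • e + y • e'⟫ ≤ 1 := by
        simp only [map_add, map_smul, inner_add_left, inner_add_right, real_inner_smul_left,
          real_inner_smul_right, he1, h0, h0']
        nlinarith [sq_nonneg y]
      have h4 : √⟪Q (x • e + y • e'), x • e + y • e'⟫ ^ 3 ≤ 1 :=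
        pow_le_one₀ (Real.sqrt_nonneg _) (Real.sqrt_le_one.2 h3)
      have h5 : ⟪T (x • e + y • e') (x • e + y • e'), x • e + y • e'⟫ =
          ⟪T e e, e⟫ * x ^ 3 + 3 * ⟪T e e, e'⟫ * (x ^ 2 * y) + 3 * ⟪T e e', e'⟫ * (x * y ^ 2)
            + ⟪T e' e', e'⟫ * y ^ 3 := by
        simp only [map_add, map_smul, add_apply,
          smul_apply, inner_add_left, inner_add_right,
          real_inner_smul_left, real_inner_smul_right]
        rw [hT₁ e' e, hT₂ e e' e, hT₂ e' e' e, hT₁ e' e]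
        ring
      linarith)
  have hcs : ⟪T e e, u⟫ ≤ 2 * √⟪Q u, u⟫ := by
    have hTu : ⟪T e e, u⟫ = a * ⟪T e e, e⟫ + b * ⟪T e e, e'⟫ := by
      rw [hu, inner_add_right, real_inner_smul_right, real_inner_smul_right]
    rw [hTu, hQu]
    set A := ⟪T e e, e⟫
    set B := ⟪T e e, e'⟫
    calc a * A + b * B ≤ √((A ^ 2 + B ^ 2) * (a ^ 2 + b ^ 2)) := by
          apply Real.le_sqrt_of_sq_le
          nlinarith [sq_nonneg (a * B - b * A)]
      _ = √(A ^ 2 + B ^ 2) * √(a ^ 2 + b ^ 2) := Real.sqrt_mul (by positivity) _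
      _ ≤ 2 * √(a ^ 2 + b ^ 2) := by gcongr
  have h6 : ⟪T h h, u⟫ = r ^ 2 * ⟪T e e, u⟫ := by
    rw [hhe]
    simp only [map_smul, smul_apply, real_inner_smul_left]
    ring
  rw [h6, ← hr2]
  nlinarith [mul_le_mul_of_nonneg_left hcs (sq_nonneg r)]

end Trilinear

section Calculus

variable {E : Type*} [NormedAddCommGroup E] [InnerProductSpace ℝ E] [CompleteSpace E]
  {f : E → ℝ} {x : E}

/-- The real-linear continuous inverse of the Riesz map. -/
noncomputable def rieszInv (E : Type*) [NormedAddCommGroup E] [InnerProductSpace ℝ E]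
    [CompleteSpace E] : StrongDual ℝ E →L[ℝ] E :=
  LinearMap.mkContinuous
    { toFun := fun l => (InnerProductSpace.toDual ℝ E).symm l
      map_add' := by intro a b; simp
      map_smul' := by intro a b; simp } 1 (by intro l; simp)

theorem inner_rieszInv (l : StrongDual ℝ E) (v : E) : ⟪rieszInv E l, v⟫ = l v := by
  simp [rieszInv]

theorem gradient_eq_rieszInv_comp (f : E → ℝ) : gradient f = rieszInv E ∘ fderiv ℝ f := rfl

theorem ContDiffAt.hasGradientAt' (hf : ContDiffAt ℝ 3 f x) :
    HasGradientAt f (gradient f x) x :=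
  (hf.differentiableAt (by norm_num)).hasGradientAt

theorem ContDiffAt.contDiffAt_gradient (hf : ContDiffAt ℝ 3 f x) :
    ContDiffAt ℝ 2 (gradient f) x := by
  rw [gradient_eq_rieszInv_comp]
  exact (rieszInv E).contDiff.contDiffAt.comp x (hf.fderiv_right (by norm_num))

theorem ContDiffAt.hasFDerivAt_gradient (hf : ContDiffAt ℝ 3 f x) :
    HasFDerivAt (gradient f) (hessOp f x) x :=
  (hf.contDiffAt_gradient.differentiableAt (by norm_num)).hasFDerivAt

theorem ContDiffAt.contDiffAt_hessOp (hf : ContDiffAt ℝ 3 f x) :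
    ContDiffAt ℝ 1 (hessOp f) x :=
  hf.contDiffAt_gradient.fderiv_right (by norm_num)

theorem ContDiffAt.hasFDerivAt_hessOp (hf : ContDiffAt ℝ 3 f x) :
    HasFDerivAt (hessOp f) (fderiv ℝ (hessOp f) x) x :=
  (hf.contDiffAt_hessOp.differentiableAt (by norm_num)).hasFDerivAt

theorem ContDiffAt.inner_hessOp (hf : ContDiffAt ℝ 3 f x) (u v : E) :
    ⟪hessOp f x u, v⟫ = fderiv ℝ (fderiv ℝ f) x u v := by
  have h1 : HasFDerivAt (fderiv ℝ f) (fderiv ℝ (fderiv ℝ f) x) x :=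
    ((hf.fderiv_right (m := 2) (by norm_num)).differentiableAt (by norm_num)).hasFDerivAt
  have h2 := (rieszInv E).hasFDerivAt.comp x h1
  rw [hessOp, gradient_eq_rieszInv_comp, h2.fderiv]
  exact inner_rieszInv _ _

theorem ContDiffAt.inner_hessOp_comm (hf : ContDiffAt ℝ 3 f x) (u v : E) :
    ⟪hessOp f x u, v⟫ = ⟪hessOp f x v, u⟫ := by
  rw [hf.inner_hessOp, hf.inner_hessOp]
  exact (hf.isSymmSndFDerivAt (by simp; norm_num)).eq u v

theorem ContDiffAt.fderiv_hessOp_comm (hf : ContDiffAt ℝ 3 f x) (u v : E) :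
    fderiv ℝ (hessOp f) x u v = fderiv ℝ (hessOp f) x v u :=
  (hf.contDiffAt_gradient.isSymmSndFDerivAt (by simp)).eq u v

theorem ContDiffAt.hasFDerivAt_inner_hessOp (hf : ContDiffAt ℝ 3 f x) (v w : E) :
    HasFDerivAt (fun y => ⟪hessOp f y v, w⟫)
      ((innerSL ℝ w) ∘L ((fderiv ℝ (hessOp f) x).flip v)) x := by
  have h1 : HasFDerivAt (fun y => hessOp f y v) ((fderiv ℝ (hessOp f) x).flip v) x := by
    simpa using hf.hasFDerivAt_hessOp.clm_apply (hasFDerivAt_const v x)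
  have h2 := (innerSL ℝ w).hasFDerivAt.comp x h1
  refine h2.congr_of_eventuallyEq (Filter.Eventually.of_forall fun y => ?_)
  simp [real_inner_comm]

theorem ContDiffAt.inner_fderiv_hessOp_comm (hf : ContDiffAt ℝ 3 f x) (u v w : E) :
    ⟪fderiv ℝ (hessOp f) x u v, w⟫ = ⟪fderiv ℝ (hessOp f) x u w, v⟫ := by
  have h1 := hf.hasFDerivAt_inner_hessOp v w
  have h2 := hf.hasFDerivAt_inner_hessOp w v
  have h3 : (fun y => ⟪hessOp f y v, w⟫) =ᶠ[nhds x] fun y => ⟪hessOp f y w, v⟫ :=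
    (hf.eventually (by simp)).mono fun y hy => hy.inner_hessOp_comm v w
  have h4 := congrArg (fun l => l u) (h1.unique (h2.congr_of_eventuallyEq h3))
  simpa [real_inner_comm] using h4

theorem ContDiffAt.iteratedFDeriv_two_eq (hf : ContDiffAt ℝ 3 f x) (h : E) :
    iteratedFDeriv ℝ 2 f x (fun _ => h) = ⟪hessOp f x h, h⟫ := by
  rw [iteratedFDeriv_two_apply, hf.inner_hessOp]

theorem ContDiffAt.iteratedFDeriv_three_eq (hf : ContDiffAt ℝ 3 f x) (h : E) :
    iteratedFDeriv ℝ 3 f x (fun _ => h) = ⟪fderiv ℝ (hessOp f) x h h, h⟫ := by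
  have h1 : HasFDerivAt (iteratedFDeriv ℝ 2 f) (fderiv ℝ (iteratedFDeriv ℝ 2 f) x) x :=
    (hf.differentiableAt_iteratedFDeriv (by norm_num)).hasFDerivAt
  have h2 : HasFDerivAt (fun y => iteratedFDeriv ℝ 2 f y (fun _ => h))
      ((ContinuousMultilinearMap.apply ℝ (fun _ : Fin 2 => E) ℝ (fun _ => h)) ∘L
        (fderiv ℝ (iteratedFDeriv ℝ 2 f) x)) x :=
    (ContinuousMultilinearMap.apply ℝ (fun _ : Fin 2 => E) ℝ (fun _ => h)).hasFDerivAt.comp x h1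
  have h3 : (fun y => iteratedFDeriv ℝ 2 f y (fun _ => h)) =ᶠ[nhds x]
      fun y => ⟪hessOp f y h, h⟫ :=
    (hf.eventually (by simp)).mono fun y hy => hy.iteratedFDeriv_two_eq h
  have h4 := congrArg (fun l => l h)
    (h2.unique ((hf.hasFDerivAt_inner_hessOp h h).congr_of_eventuallyEq h3))
  rw [iteratedFDeriv_succ_apply_left]
  simpa [real_inner_comm, Fin.tail_def] using h4

end Calculus

section Monotonicity

theorem le_of_hasDerivAt_nonpos {g g' : ℝ → ℝ} {b : ℝ} (hb : 0 ≤ b)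
    (hg : ∀ τ ∈ Set.Icc 0 b, HasDerivAt g (g' τ) τ) (hg' : ∀ τ ∈ Set.Icc 0 b, g' τ ≤ 0) :
    g b ≤ g 0 := by
  have h := (convex_Icc (0 : ℝ) b).image_sub_le_mul_sub_of_deriv_le (f := g) (C := 0)
    (fun τ hτ => (hg τ hτ).continuousAt.continuousWithinAt)
    (fun τ hτ => (hg τ (interior_subset hτ)).differentiableAt.differentiableWithinAt)
    (fun τ hτ => by
      rw [(hg τ (interior_subset hτ)).deriv]
      exact hg' τ (interior_subset hτ))
    0 (Set.left_mem_Icc.2 hb) b (Set.right_mem_Icc.2 hb) hb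
  linarith

theorem le_of_hasDerivAt_of_hasDerivAt_nonpos {g g' g'' : ℝ → ℝ} {b : ℝ} (hb : 0 ≤ b)
    (hg : ∀ τ ∈ Set.Icc 0 b, HasDerivAt g (g' τ) τ)
    (hg' : ∀ τ ∈ Set.Icc 0 b, HasDerivAt g' (g'' τ) τ)
    (hg'' : ∀ τ ∈ Set.Icc 0 b, g'' τ ≤ 0) (h0 : g' 0 ≤ 0) :
    g b ≤ g 0 := by
  refine le_of_hasDerivAt_nonpos hb hg fun τ hτ => ?_
  have hsub : Set.Icc 0 τ ⊆ Set.Icc 0 b := Set.Icc_subset_Icc_right hτ.2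
  exact (le_of_hasDerivAt_nonpos hτ.1 (fun σ hσ => hg' σ (hsub hσ))
    fun σ hσ => hg'' σ (hsub hσ)).trans h0

theorem hasDerivAt_line {E : Type*} [NormedAddCommGroup E] [NormedSpace ℝ E] (x h : E) (τ : ℝ) : HasDerivAt (fun τ : ℝ => x + τ • h) h τ := by
  simpa using ((hasDerivAt_id τ).smul_const h).const_add x

end Monotonicity

section SelfConcordance

variable {E : Type*} [NormedAddCommGroup E] [InnerProductSpace ℝ E] [CompleteSpace E]

/-- A self-concordant function with positive definite Hessians. -/
structure PosDefSelfConcordantOn (f : E → ℝ) (D : Set E) : Prop where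
  selfConcordantOn : SelfConcordantOn f D
  hessOp_pos : ∀ x ∈ D, ∀ u : E, u ≠ 0 → 0 < ⟪hessOp f x u, u⟫

/-- The local norm `‖u‖_x`. -/
noncomputable def localNorm (f : E → ℝ) (x u : E) : ℝ := √⟪hessOp f x u, u⟫

theorem localNorm_nonneg (f : E → ℝ) (x u : E) : 0 ≤ localNorm f x u := Real.sqrt_nonneg _

theorem localNorm_smul (f : E → ℝ) (x u : E) (c : ℝ) :
    localNorm f x (c • u) = |c| * localNorm f x u := by
  rw [localNorm, map_smul, real_inner_smul_left, real_inner_smul_right, ← mul_assoc,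
    Real.sqrt_mul (mul_self_nonneg c), Real.sqrt_mul_self_eq_abs, localNorm]

namespace PosDefSelfConcordantOn

variable {f : E → ℝ} {D : Set E} {x h : E}

theorem contDiffAt (hf : PosDefSelfConcordantOn f D) (hx : x ∈ D) : ContDiffAt ℝ 3 f x :=
  hf.selfConcordantOn.2.2.1.contDiffAt (hf.selfConcordantOn.1.mem_nhds hx)

theorem inner_hessOp_nonneg (hf : PosDefSelfConcordantOn f D) (hx : x ∈ D) (u : E) :
    0 ≤ ⟪hessOp f x u, u⟫ := by
  by_cases hu : u = 0
  · simp [hu]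
  · exact (hf.hessOp_pos x hx u hu).le

theorem sq_localNorm (hf : PosDefSelfConcordantOn f D) (hx : x ∈ D) (u : E) :
    localNorm f x u ^ 2 = ⟪hessOp f x u, u⟫ :=
  Real.sq_sqrt (hf.inner_hessOp_nonneg hx u)

theorem localNorm_pos (hf : PosDefSelfConcordantOn f D) (hx : x ∈ D) (hh : h ≠ 0) :
    0 < localNorm f x h :=
  Real.sqrt_pos.2 (hf.hessOp_pos x hx h hh)

/-- The Cauchy-Schwarz inequality for the local inner product. -/
theorem inner_hessOp_le (hf : PosDefSelfConcordantOn f D) (hx : x ∈ D) (u v : E) :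
    ⟪hessOp f x u, v⟫ ≤ localNorm f x u * localNorm f x v := by
  set a := localNorm f x u with ha
  set b := localNorm f x v with hb
  have hsym := (hf.contDiffAt hx).inner_hessOp_comm v u
  have h1 := hf.inner_hessOp_nonneg hx (b • u - a • v)
  have h2 : ⟪hessOp f x (b • u - a • v), b • u - a • v⟫ =
      2 * (a * b) * (a * b - ⟪hessOp f x u, v⟫) := by
    simp only [map_sub, map_smul, inner_sub_left, inner_sub_right, real_inner_smul_left,
      real_inner_smul_right, hsym, ← hf.sq_localNorm hx, ← ha, ← hb]
    ring
  rw [h2] at h1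
  by_cases hu : u = 0
  · simp [ha, hu, localNorm]
  by_cases hv : v = 0
  · simp [hb, hv, localNorm]
  have h3 := hf.localNorm_pos hx hu
  have h4 := hf.localNorm_pos hx hv
  linarith [nonneg_of_mul_nonneg_right h1 (by positivity)]

theorem localNorm_add_le (hf : PosDefSelfConcordantOn f D) (hx : x ∈ D) (u v : E) :
    localNorm f x (u + v) ≤ localNorm f x u + localNorm f x v := by
  refine abs_le_of_sq_le_sq' ?_ (add_nonneg (localNorm_nonneg _ _ _)
    (localNorm_nonneg _ _ _)) |>.2
  have hsym := (hf.contDiffAt hx).inner_hessOp_comm v u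
  have h1 := hf.inner_hessOp_le hx u v
  rw [add_sq, hf.sq_localNorm hx, hf.sq_localNorm hx, hf.sq_localNorm hx, map_add,
    inner_add_left, inner_add_right, inner_add_right]
  linarith

theorem inner_third_diag_le (hf : PosDefSelfConcordantOn f D) (hx : x ∈ D) (h : E) :
    ⟪fderiv ℝ (hessOp f) x h h, h⟫ ≤ 2 * localNorm f x h ^ 3 := by
  have h1 := hf.selfConcordantOn.2.2.2 x hx h
  rw [(hf.contDiffAt hx).iteratedFDeriv_two_eq, (hf.contDiffAt hx).iteratedFDeriv_three_eq,
    ← hf.sq_localNorm hx, ← Real.rpow_natCast, ← Real.rpow_mul (localNorm_nonneg _ _ _)] at h1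
  norm_num at h1
  exact_mod_cast h1

theorem inner_third_le (hf : PosDefSelfConcordantOn f D) (hx : x ∈ D) (h u : E) :
    ⟪fderiv ℝ (hessOp f) x h h, u⟫ ≤ 2 * localNorm f x h ^ 2 * localNorm f x u := by
  rw [hf.sq_localNorm hx]
  exact inner_trilinear_le (hf.contDiffAt hx).inner_hessOp_comm (hf.hessOp_pos x hx)
    (hf.contDiffAt hx).fderiv_hessOp_comm (hf.contDiffAt hx).inner_fderiv_hessOp_comm
    (hf.inner_third_diag_le hx) h u

theorem inner_third_le' (hf : PosDefSelfConcordantOn f D) (hx : x ∈ D) (h u : E) :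
    ⟪fderiv ℝ (hessOp f) x h u, u⟫ ≤ 2 * localNorm f x h * localNorm f x u ^ 2 := by
  rw [(hf.contDiffAt hx).fderiv_hessOp_comm, (hf.contDiffAt hx).inner_fderiv_hessOp_comm]
  linarith [hf.inner_third_le hx u h]

theorem abs_inner_third_diag_le (hf : PosDefSelfConcordantOn f D) (hx : x ∈ D) (h : E) :
    |⟪fderiv ℝ (hessOp f) x h h, h⟫| ≤ 2 * localNorm f x h ^ 3 := by
  rw [abs_le]
  refine ⟨?_, hf.inner_third_diag_le hx h⟩
  have h1 := hf.inner_third_diag_le hx (-h)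
  have h2 : localNorm f x (-h) = localNorm f x h := by simp [localNorm]
  rw [h2] at h1
  simp only [map_neg, neg_apply, inner_neg_right,
    neg_neg] at h1
  linarith

theorem add_smul_mem (hf : PosDefSelfConcordantOn f D) (hx : x ∈ D) (hxh : x + h ∈ D)
    {τ : ℝ} (hτ : τ ∈ Set.Icc (0 : ℝ) 1) : x + τ • h ∈ D := by
  have := hf.selfConcordantOn.2.1.add_smul_sub_mem hx hxh hτ
  simpa using this

theorem hasDerivAt_comp_line (hf : PosDefSelfConcordantOn f D) {τ : ℝ} (hx : x + τ • h ∈ D) :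
    HasDerivAt (fun τ : ℝ => f (x + τ • h)) ⟪gradient f (x + τ • h), h⟫ τ := by
  have h1 := (hf.contDiffAt hx).hasGradientAt'.hasFDerivAt.comp_hasDerivAt τ
    (hasDerivAt_line x h τ)
  simpa [Function.comp_def] using h1

theorem hasDerivAt_inner_gradient (hf : PosDefSelfConcordantOn f D) {τ : ℝ}
    (hx : x + τ • h ∈ D) (u : E) :
    HasDerivAt (fun τ : ℝ => ⟪gradient f (x + τ • h), u⟫) ⟪hessOp f (x + τ • h) h, u⟫ τ := by
  have h1 := (hf.contDiffAt hx).hasFDerivAt_gradient.comp_hasDerivAt τ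
    (hasDerivAt_line x h τ)
  simpa using h1.inner ℝ (hasDerivAt_const τ u)

theorem hasDerivAt_inner_hessOp (hf : PosDefSelfConcordantOn f D) {τ : ℝ}
    (hx : x + τ • h ∈ D) (u v : E) :
    HasDerivAt (fun τ : ℝ => ⟪hessOp f (x + τ • h) u, v⟫)
      ⟪fderiv ℝ (hessOp f) (x + τ • h) h u, v⟫ τ := by
  have h1 := ((hf.contDiffAt hx).hasFDerivAt_inner_hessOp u v).comp_hasDerivAt τ
    (hasDerivAt_line x h τ)
  simpa [real_inner_comm, Function.comp_def] using h1

theorem abs_inv_localNorm_sub_le (hf : PosDefSelfConcordantOn f D) (hx : x ∈ D)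
    (hxh : x + h ∈ D) (hh : h ≠ 0) {τ : ℝ} (hτ : τ ∈ Set.Icc (0 : ℝ) 1) :
    |(localNorm f (x + τ • h) h)⁻¹ - (localNorm f x h)⁻¹| ≤ τ := by
  have hderiv : ∀ σ ∈ Set.Icc (0 : ℝ) 1, HasDerivWithinAt
      (fun σ : ℝ => (localNorm f (x + σ • h) h)⁻¹)
      (-(⟪fderiv ℝ (hessOp f) (x + σ • h) h h, h⟫ / (2 * localNorm f (x + σ • h) h)) /
        localNorm f (x + σ • h) h ^ 2) (Set.Icc 0 1) σ := by
    intro σ hσ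
    have hm := hf.add_smul_mem hx hxh hσ
    exact (((hf.hasDerivAt_inner_hessOp hm h h).sqrt (hf.hessOp_pos _ hm h hh).ne').inv
      (hf.localNorm_pos hm hh).ne').hasDerivWithinAt
  have hbound : ∀ σ ∈ Set.Icc (0 : ℝ) 1,
      ‖-(⟪fderiv ℝ (hessOp f) (x + σ • h) h h, h⟫ / (2 * localNorm f (x + σ • h) h)) /
        localNorm f (x + σ • h) h ^ 2‖ ≤ 1 := by
    intro σ hσ
    have hm := hf.add_smul_mem hx hxh hσ
    have hpos := hf.localNorm_pos hm hh
    have h1 := hf.abs_inner_third_diag_le hm h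
    rw [norm_div, norm_neg, norm_div, Real.norm_eq_abs, Real.norm_of_nonneg (by positivity),
      Real.norm_of_nonneg (by positivity), div_div, div_le_one (by positivity)]
    linarith
  have h2 := (convex_Icc (0 : ℝ) 1).norm_image_sub_le_of_norm_hasDerivWithin_le hderiv hbound
    (Set.left_mem_Icc.2 zero_le_one) hτ
  simpa [abs_of_nonneg hτ.1] using h2

theorem localNorm_line_le (hf : PosDefSelfConcordantOn f D) (hx : x ∈ D) (hxh : x + h ∈ D)
    (hr : localNorm f x h < 1) {τ : ℝ} (hτ : τ ∈ Set.Icc (0 : ℝ) 1) :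
    localNorm f (x + τ • h) h ≤ localNorm f x h / (1 - localNorm f x h * τ) := by
  by_cases hh : h = 0
  · simp [hh, localNorm]
  have h1 := (abs_le.1 (hf.abs_inv_localNorm_sub_le hx hxh hh hτ)).1
  have h2 := hf.localNorm_pos (hf.add_smul_mem hx hxh hτ) hh
  have h3 := hf.localNorm_pos hx hh
  set r := localNorm f x h
  set s := localNorm f (x + τ • h) h
  have h4 : 0 < 1 - r * τ := by nlinarith [hτ.1, hτ.2]
  rw [le_div_iff₀ h4]
  have h5 := mul_le_mul_of_nonneg_left h1 (mul_pos h2 h3).le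
  have h6 : s * r * (s⁻¹ - r⁻¹) = r - s := by field_simp
  nlinarith

theorem le_localNorm_line (hf : PosDefSelfConcordantOn f D) (hx : x ∈ D) (hxh : x + h ∈ D)
    {τ : ℝ} (hτ : τ ∈ Set.Icc (0 : ℝ) 1) :
    localNorm f x h / (1 + localNorm f x h * τ) ≤ localNorm f (x + τ • h) h := by
  by_cases hh : h = 0
  · simp [hh, localNorm]
  have h1 := (abs_le.1 (hf.abs_inv_localNorm_sub_le hx hxh hh hτ)).2
  have h2 := hf.localNorm_pos (hf.add_smul_mem hx hxh hτ) hh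
  have h3 := hf.localNorm_pos hx hh
  set r := localNorm f x h
  set s := localNorm f (x + τ • h) h
  have h4 : 0 < 1 + r * τ := by nlinarith [hτ.1, hτ.2]
  rw [div_le_iff₀ h4]
  have h5 := mul_le_mul_of_nonneg_left h1 (mul_pos h2 h3).le
  have h6 : s * r * (s⁻¹ - r⁻¹) = r - s := by field_simp
  nlinarith

theorem localNorm_line_le_of_localNorm_lt_one (hf : PosDefSelfConcordantOn f D) (hx : x ∈ D)
    (hxh : x + h ∈ D) (hr : localNorm f x h < 1) (u : E) {τ : ℝ}
    (hτ : τ ∈ Set.Icc (0 : ℝ) 1) :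
    localNorm f (x + τ • h) u ≤ localNorm f x u / (1 - localNorm f x h * τ) := by
  have hr0 := localNorm_nonneg f x h
  have hsub : ∀ {σ}, σ ∈ Set.Icc 0 τ → σ ∈ Set.Icc (0 : ℝ) 1 :=
    fun hσ => ⟨hσ.1, hσ.2.trans hτ.2⟩
  have hpos : ∀ σ ∈ Set.Icc (0 : ℝ) 1, 0 < 1 - localNorm f x h * σ := by
    intro σ hσ; nlinarith [hσ.1, hσ.2]
  have h1 := le_of_hasDerivAt_nonpos
    (g := fun σ => ⟪hessOp f (x + σ • h) u, u⟫ * (1 - localNorm f x h * σ) ^ 2) hτ.1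
    (fun σ hσ => (hf.hasDerivAt_inner_hessOp (hf.add_smul_mem hx hxh (hsub hσ)) u u).mul
      ((((hasDerivAt_id σ).const_mul (localNorm f x h)).const_sub 1).pow 2))
    (fun σ hσ => by
      have hm := hf.add_smul_mem hx hxh (hsub hσ)
      have h2 := hf.inner_third_le' hm h u
      have h3 := hf.localNorm_line_le hx hxh hr (hsub hσ)
      have h4 := hpos σ (hsub hσ)
      rw [le_div_iff₀ h4] at h3
      rw [← hf.sq_localNorm hm u]
      simp only [id]
      set r := localNorm f x h
      set s := localNorm f (x + σ • h) h
      set q := localNorm f (x + σ • h) u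
      have h5 := mul_le_mul_of_nonneg_right h2 (sq_nonneg (1 - r * σ))
      have h6 := mul_le_mul_of_nonneg_left h3
        (show 0 ≤ 2 * q ^ 2 * (1 - r * σ) by positivity)
      norm_num
      nlinarith)
  have hm := hf.add_smul_mem hx hxh hτ
  simp only [zero_smul, add_zero, mul_zero, sub_zero, one_pow, mul_one] at h1
  rw [← hf.sq_localNorm hx, ← hf.sq_localNorm hm, ← mul_pow] at h1
  rw [le_div_iff₀ (hpos τ hτ)]
  exact (pow_le_pow_iff_left₀
    (mul_nonneg (localNorm_nonneg _ _ _) (hpos τ hτ).le) (localNorm_nonneg _ _ _) two_ne_zero).1 h1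

theorem localNorm_add_point_le (hf : PosDefSelfConcordantOn f D) (hx : x ∈ D)
    (hxh : x + h ∈ D) (hr : localNorm f x h < 1) (u : E) :
    localNorm f (x + h) u ≤ localNorm f x u / (1 - localNorm f x h) := by
  simpa using hf.localNorm_line_le_of_localNorm_lt_one hx hxh hr u
    (Set.right_mem_Icc.2 zero_le_one)

theorem le_add_omegaStar (hf : PosDefSelfConcordantOn f D) (hx : x ∈ D) (hxh : x + h ∈ D)
    (hr : localNorm f x h < 1) :
    f (x + h) ≤ f x + ⟪gradient f x, h⟫ + omegaStar (localNorm f x h) := by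
  have hr0 := localNorm_nonneg f x h
  have hpos : ∀ σ ∈ Set.Icc (0 : ℝ) 1, 0 < 1 - localNorm f x h * σ := by
    intro σ hσ; nlinarith [hσ.1, hσ.2]
  have hω : ∀ σ ∈ Set.Icc (0 : ℝ) 1, HasDerivAt (fun σ => omegaStar (localNorm f x h * σ))
      (-localNorm f x h - (-localNorm f x h) / (1 - localNorm f x h * σ)) σ := by
    intro σ hσ
    have h1 : HasDerivAt (fun σ => localNorm f x h * σ) (localNorm f x h) σ := by
      simpa using (hasDerivAt_id σ).const_mul (localNorm f x h)
    exact h1.neg.sub ((h1.const_sub 1).log (hpos σ hσ).ne')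
  have hω' : ∀ σ ∈ Set.Icc (0 : ℝ) 1, HasDerivAt
      (fun σ => -localNorm f x h - (-localNorm f x h) / (1 - localNorm f x h * σ))
      (localNorm f x h ^ 2 / (1 - localNorm f x h * σ) ^ 2) σ := by
    intro σ hσ
    have h1 : HasDerivAt (fun σ => localNorm f x h * σ) (localNorm f x h) σ := by
      simpa using (hasDerivAt_id σ).const_mul (localNorm f x h)
    exact (((hasDerivAt_const σ (-localNorm f x h)).div (h1.const_sub 1)
      (hpos σ hσ).ne').const_sub (-localNorm f x h)).congr_deriv (by ring)
  have key := le_of_hasDerivAt_of_hasDerivAt_nonpos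
    (g := fun σ => f (x + σ • h) - σ * ⟪gradient f x, h⟫ - omegaStar (localNorm f x h * σ))
    (b := 1) zero_le_one
    (fun σ hσ => ((hf.hasDerivAt_comp_line (hf.add_smul_mem hx hxh hσ)).sub
      ((hasDerivAt_id σ).mul_const _)).sub (hω σ hσ))
    (fun σ hσ => ((hf.hasDerivAt_inner_gradient (hf.add_smul_mem hx hxh hσ) h).sub_const
      _).sub (hω' σ hσ))
    (fun σ hσ => by
      have h3 := hf.localNorm_line_le hx hxh hr hσ
      rw [← hf.sq_localNorm (hf.add_smul_mem hx hxh hσ), sub_nonpos, ← div_pow]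
      exact pow_le_pow_left₀ (localNorm_nonneg _ _ _) h3 2)
    (by simp)
  simp [omegaStar, -inner_gradient_left] at key
  simp only [omegaStar]
  linarith

theorem add_log_le (hf : PosDefSelfConcordantOn f D) (hx : x ∈ D) (hxh : x + h ∈ D) :
    f x + ⟪gradient f x, h⟫ + (localNorm f x h - Real.log (1 + localNorm f x h)) ≤
      f (x + h) := by
  have hr0 := localNorm_nonneg f x h
  have hpos : ∀ σ ∈ Set.Icc (0 : ℝ) 1, 0 < 1 + localNorm f x h * σ := by
    intro σ hσ; nlinarith [hσ.1, hσ.2]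
  have hω : ∀ σ ∈ Set.Icc (0 : ℝ) 1, HasDerivAt
      (fun σ => localNorm f x h * σ - Real.log (1 + localNorm f x h * σ))
      (localNorm f x h - localNorm f x h / (1 + localNorm f x h * σ)) σ := by
    intro σ hσ
    have h1 : HasDerivAt (fun σ => localNorm f x h * σ) (localNorm f x h) σ := by
      simpa using (hasDerivAt_id σ).const_mul (localNorm f x h)
    exact h1.sub ((h1.const_add 1).log (hpos σ hσ).ne')
  have hω' : ∀ σ ∈ Set.Icc (0 : ℝ) 1, HasDerivAt
      (fun σ => localNorm f x h - localNorm f x h / (1 + localNorm f x h * σ))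
      (localNorm f x h ^ 2 / (1 + localNorm f x h * σ) ^ 2) σ := by
    intro σ hσ
    have h1 : HasDerivAt (fun σ => localNorm f x h * σ) (localNorm f x h) σ := by
      simpa using (hasDerivAt_id σ).const_mul (localNorm f x h)
    exact (((hasDerivAt_const σ (localNorm f x h)).div (h1.const_add 1)
      (hpos σ hσ).ne').const_sub (localNorm f x h)).congr_deriv (by ring)
  have key := le_of_hasDerivAt_of_hasDerivAt_nonpos
    (g := fun σ => localNorm f x h * σ - Real.log (1 + localNorm f x h * σ)
      - (f (x + σ • h) - σ * ⟪gradient f x, h⟫))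
    (b := 1) zero_le_one
    (fun σ hσ => (hω σ hσ).sub ((hf.hasDerivAt_comp_line (hf.add_smul_mem hx hxh hσ)).sub
      ((hasDerivAt_id σ).mul_const _)))
    (fun σ hσ => (hω' σ hσ).sub
      ((hf.hasDerivAt_inner_gradient (hf.add_smul_mem hx hxh hσ) h).sub_const _))
    (fun σ hσ => by
      have h3 := hf.le_localNorm_line hx hxh hσ
      rw [← hf.sq_localNorm (hf.add_smul_mem hx hxh hσ), sub_nonpos, ← div_pow]
      exact pow_le_pow_left₀ (div_nonneg hr0 (hpos σ hσ).le) h3 2)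
    (by simp)
  simp [-inner_gradient_left] at key
  linarith

/-- The gradient is approximated by its linearization, in the dual local norm. -/
theorem inner_gradient_sub_le (hf : PosDefSelfConcordantOn f D) (hx : x ∈ D) (hxh : x + h ∈ D)
    (hr : localNorm f x h < 1) (u : E) :
    ⟪gradient f (x + h) - gradient f x - hessOp f x h, u⟫ ≤
      localNorm f x h ^ 2 / (1 - localNorm f x h) * localNorm f x u := by
  have hr0 := localNorm_nonneg f x h
  have hpos : ∀ σ ∈ Set.Icc (0 : ℝ) 1, 0 < 1 - localNorm f x h * σ := by
    intro σ hσ; nlinarith [hσ.1, hσ.2]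
  have h1 : ∀ σ, HasDerivAt (fun σ => 1 - localNorm f x h * σ) (-localNorm f x h) σ := by
    intro σ
    simpa using ((hasDerivAt_id σ).const_mul (localNorm f x h)).const_sub 1
  have hω : ∀ σ ∈ Set.Icc (0 : ℝ) 1, HasDerivAt
      (fun σ => (1 - localNorm f x h * σ)⁻¹ * localNorm f x u)
      (localNorm f x h / (1 - localNorm f x h * σ) ^ 2 * localNorm f x u) σ := by
    intro σ hσ
    simpa using ((h1 σ).inv (hpos σ hσ).ne').mul_const (localNorm f x u)
  have hω' : ∀ σ ∈ Set.Icc (0 : ℝ) 1, HasDerivAt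
      (fun σ => localNorm f x h / (1 - localNorm f x h * σ) ^ 2 * localNorm f x u)
      (2 * localNorm f x h ^ 2 / (1 - localNorm f x h * σ) ^ 3 * localNorm f x u) σ := by
    intro σ hσ
    have h2 := hpos σ hσ
    refine (((hasDerivAt_const σ (localNorm f x h)).div ((h1 σ).pow 2)
      (pow_pos h2 2).ne').mul_const (localNorm f x u)).congr_deriv ?_
    field_simp
    norm_num
    ring
  have key := le_of_hasDerivAt_of_hasDerivAt_nonpos
    (g := fun σ => ⟪gradient f (x + σ • h), u⟫ - σ * ⟪hessOp f x h, u⟫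
      - ((1 - localNorm f x h * σ)⁻¹ * localNorm f x u
        - σ * (localNorm f x h * localNorm f x u)))
    (b := 1) zero_le_one
    (fun σ hσ => ((hf.hasDerivAt_inner_gradient (hf.add_smul_mem hx hxh hσ) u).sub
      ((hasDerivAt_id σ).mul_const _)).sub ((hω σ hσ).sub ((hasDerivAt_id σ).mul_const _)))
    (fun σ hσ => ((hf.hasDerivAt_inner_hessOp (hf.add_smul_mem hx hxh hσ) h u).sub_const
      _).sub ((hω' σ hσ).sub_const _))
    (fun σ hσ => by
      have hm := hf.add_smul_mem hx hxh hσ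
      have h2 := hpos σ hσ
      have h3 := hf.localNorm_line_le hx hxh hr hσ
      have h4 := hf.localNorm_line_le_of_localNorm_lt_one hx hxh hr u hσ
      rw [sub_nonpos]
      calc _ ≤ 2 * localNorm f (x + σ • h) h ^ 2 * localNorm f (x + σ • h) u :=
            hf.inner_third_le hm h u
        _ ≤ 2 * (localNorm f x h / (1 - localNorm f x h * σ)) ^ 2 *
            (localNorm f x u / (1 - localNorm f x h * σ)) := by
              gcongr <;> exact localNorm_nonneg _ _ _
        _ = _ := by field_simp)
    (by simp)
  have h2 := hpos 1 ⟨zero_le_one, le_rfl⟩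
  simp [-inner_gradient_left] at key h2
  rw [inner_sub_left, inner_sub_left]
  have h5 : localNorm f x h ^ 2 / (1 - localNorm f x h) * localNorm f x u =
      (1 - localNorm f x h)⁻¹ * localNorm f x u - localNorm f x h * localNorm f x u
        - localNorm f x u := by
    have : 1 - localNorm f x h ≠ 0 := by linarith
    field_simp
    ring
  linarith

end PosDefSelfConcordantOn

end SelfConcordance

section Barrier

variable {E : Type*} [NormedAddCommGroup E] [InnerProductSpace ℝ E] [CompleteSpace E]

/-- `f` tends to `+∞` along sequences in the interior of `K` converging to the boundary. -/
def BlowsUpAtFrontier (f : E → ℝ) (K : Set E) : Prop :=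
  ∀ z ∈ frontier K, ∀ u : ℕ → E, (∀ i, u i ∈ interior K) →
    Filter.Tendsto u Filter.atTop (nhds z) →
    Filter.Tendsto (fun i => f (u i)) Filter.atTop Filter.atTop

/-- The open unit ball of the local norm (Dikin ellipsoid) lies in the domain. -/
theorem PosDefSelfConcordantOn.add_mem_interior_of_localNorm_lt_one {f : E → ℝ} {K : Set E}
    {x h : E} (hf : PosDefSelfConcordantOn f (interior K)) (hK : IsClosed K)
    (hbar : BlowsUpAtFrontier f K) (hx : x ∈ interior K) (hr : localNorm f x h < 1) :
    x + h ∈ interior K := by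
  by_contra hxh
  have hr0 := localNorm_nonneg f x h
  have hcont : Continuous fun τ : ℝ => x + τ • h := by fun_prop
  have hS : IsCompact (Set.Icc (0 : ℝ) 1 ∩ (fun τ : ℝ => x + τ • h) ⁻¹' (interior K)ᶜ) :=
    isCompact_Icc.inter_right (isOpen_interior.isClosed_compl.preimage hcont)
  obtain ⟨τ₀, ⟨⟨h0, h1⟩, hτ₀⟩, hmin⟩ := hS.exists_isLeast
    ⟨1, ⟨zero_le_one, le_rfl⟩, by simpa using hxh⟩
  have hpos : 0 < τ₀ := by
    refine lt_of_le_of_ne h0 fun h => hτ₀ ?_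
    simpa [← h] using hx
  have hlt : ∀ τ, 0 ≤ τ → τ < τ₀ → x + τ • h ∈ interior K := by
    intro τ hτ hτ'
    by_contra hcon
    exact (hmin ⟨⟨hτ, hτ'.le.trans h1⟩, hcon⟩).not_gt hτ'
  set a : ℕ → ℝ := fun n => τ₀ * (1 - 1 / ((n : ℝ) + 1)) with ha
  have hfrac : ∀ n : ℕ, 0 < 1 / ((n : ℝ) + 1) ∧ 1 / ((n : ℝ) + 1) ≤ 1 := fun n =>
    ⟨by positivity, by rw [div_le_one (by positivity)]; linarith [n.cast_nonneg (α := ℝ)]⟩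
  have ha0 : ∀ n, 0 ≤ a n := fun n => mul_nonneg h0 (by linarith [(hfrac n).2])
  have ha1 : ∀ n, a n < τ₀ := fun n => by
    have := (hfrac n).1
    simp only [ha]
    nlinarith
  have hmem : ∀ n, x + a n • h ∈ interior K := fun n => hlt _ (ha0 n) (ha1 n)
  have hlim : Filter.Tendsto a Filter.atTop (nhds τ₀) := by
    have := ((tendsto_one_div_add_atTop_nhds_zero_nat (𝕜 := ℝ)).const_sub 1).const_mul τ₀
    simpa [ha] using this
  have hulim : Filter.Tendsto (fun n => x + a n • h) Filter.atTop (nhds (x + τ₀ • h)) :=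
    (hcont.tendsto τ₀).comp hlim
  have hz : x + τ₀ • h ∈ frontier K := by
    rw [hK.frontier_eq]
    exact ⟨hK.mem_of_tendsto hulim (Filter.Eventually.of_forall fun n =>
      interior_subset (hmem n)), hτ₀⟩
  have hbound : ∀ n, f (x + a n • h) ≤
      f x + a n * ⟪gradient f x, h⟫ + omegaStar (a n * localNorm f x h) := by
    intro n
    have h2 : localNorm f x (a n • h) = a n * localNorm f x h := by
      rw [localNorm_smul, abs_of_nonneg (ha0 n)]
    have h3 : a n * localNorm f x h < 1 := by nlinarith [ha0 n, ha1 n]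
    have h4 := hf.le_add_omegaStar hx (hmem n) (h2 ▸ h3)
    rwa [h2, real_inner_smul_right] at h4
  have hne : 1 - τ₀ * localNorm f x h ≠ 0 := by nlinarith
  have hblim : Filter.Tendsto (fun n => f x + a n * ⟪gradient f x, h⟫ +
      omegaStar (a n * localNorm f x h)) Filter.atTop
      (nhds (f x + τ₀ * ⟪gradient f x, h⟫ + omegaStar (τ₀ * localNorm f x h))) := by
    have h5 := hlim.mul_const (localNorm f x h)
    exact ((hlim.mul_const _).const_add _).add (h5.neg.sub ((h5.const_sub 1).log hne))
  exact not_tendsto_atTop_of_tendsto_nhds hblim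
    (Filter.tendsto_atTop_mono hbound (hbar _ hz _ hmem hulim))

/-- `F` is a `ν`-logarithmically homogeneous self-concordant barrier for the cone `K`. -/
structure IsLogHomogeneousBarrier (F : E → ℝ) (K : Set E) (ν : ℝ) : Prop where
  isClosed : IsClosed K
  convex : Convex ℝ K
  smul_mem : ∀ x ∈ K, ∀ τ : ℝ, 0 < τ → τ • x ∈ K
  one_le : 1 ≤ ν
  posDefSelfConcordantOn : PosDefSelfConcordantOn F (interior K)
  log_homogeneous : ∀ x ∈ interior K, ∀ τ : ℝ, 0 < τ → F (τ • x) = F x - ν * Real.log τ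
  blowsUpAtFrontier : BlowsUpAtFrontier F K

namespace IsLogHomogeneousBarrier

variable {F : E → ℝ} {K : Set E} {ν : ℝ} {x u : E}

open scoped Pointwise in
theorem smul_mem_interior (hF : IsLogHomogeneousBarrier F K ν) (hx : x ∈ interior K) {τ : ℝ}
    (hτ : 0 < τ) : τ • x ∈ interior K := by
  have h1 : τ • x ∈ interior (τ • K) := by
    rw [interior_smul₀ hτ.ne']
    exact Set.smul_mem_smul_set hx
  refine interior_mono ?_ h1
  rintro _ ⟨y, hy, rfl⟩
  exact hF.smul_mem y hy τ hτ

theorem add_mem_interior (hF : IsLogHomogeneousBarrier F K ν) (hx : x ∈ interior K)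
    (hu : u ∈ K) : x + u ∈ interior K := by
  have h1 := hF.convex.combo_interior_self_mem_interior hx hu (a := 1 / 2) (b := 1 / 2)
    (by norm_num) (by norm_num) (by norm_num)
  have h2 := hF.smul_mem_interior h1 (τ := 2) (by norm_num)
  rwa [smul_add, smul_smul, smul_smul, mul_one_div_cancel two_ne_zero, one_smul,
    one_smul] at h2

theorem smul_gradient_smul (hF : IsLogHomogeneousBarrier F K ν) (hx : x ∈ interior K) {τ : ℝ}
    (hτ : 0 < τ) : τ • gradient F (τ • x) = gradient F x := by
  have hτx := hF.smul_mem_interior hx hτ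
  have hd : ∀ {y}, y ∈ interior K → HasFDerivAt F (fderiv ℝ F y) y := fun hy =>
    ((hF.posDefSelfConcordantOn.contDiffAt hy).differentiableAt (by norm_num)).hasFDerivAt
  have h1 := (hd hτx).comp x ((hasFDerivAt_id x).const_smul τ)
  have h2 := (hd hx).sub_const (ν * Real.log τ)
  have h3 : (F ∘ fun y => τ • id y) =ᶠ[nhds x] fun y => F y - ν * Real.log τ := by
    filter_upwards [isOpen_interior.mem_nhds hx] with y hy
    exact hF.log_homogeneous y hy τ hτ
  have h4 := h1.unique (h2.congr_of_eventuallyEq h3)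
  rw [gradient_eq_rieszInv_comp]
  simp only [Function.comp_apply]
  rw [← map_smul, ← h4]
  congr 1
  ext v
  simp

theorem sq_smul_hessOp_smul (hF : IsLogHomogeneousBarrier F K ν) (hx : x ∈ interior K) {τ : ℝ}
    (hτ : 0 < τ) : τ ^ 2 • hessOp F (τ • x) = hessOp F x := by
  have hτx := hF.smul_mem_interior hx hτ
  have hd : ∀ {y}, y ∈ interior K → HasFDerivAt (gradient F) (hessOp F y) y := fun hy =>
    (hF.posDefSelfConcordantOn.contDiffAt hy).hasFDerivAt_gradient
  have h1 := ((hd hτx).comp x ((hasFDerivAt_id x).const_smul τ)).const_smul τ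
  have h3 : (fun y => τ • (gradient F ∘ fun y => τ • id y) y) =ᶠ[nhds x] gradient F := by
    filter_upwards [isOpen_interior.mem_nhds hx] with y hy
    exact hF.smul_gradient_smul hy hτ
  have h4 := h1.unique ((hd hx).congr_of_eventuallyEq h3)
  rw [← h4]
  ext v
  simp [smul_smul, sq]

theorem inner_gradient_self (hF : IsLogHomogeneousBarrier F K ν) (hx : x ∈ interior K) :
    ⟪gradient F x, x⟫ = -ν := by
  have h1 := hF.posDefSelfConcordantOn.hasDerivAt_comp_line (x := x) (h := x) (τ := 0)
    (by simpa using hx)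
  have h2 : HasDerivAt (fun τ : ℝ => F x - ν * Real.log (1 + τ)) (-ν) 0 := by
    have h3 := ((((hasDerivAt_id (0 : ℝ)).const_add 1).log (by simp)).const_mul ν).const_sub
      (F x)
    simpa using h3
  have h3 : (fun τ : ℝ => F (x + τ • x)) =ᶠ[nhds 0] fun τ => F x - ν * Real.log (1 + τ) := by
    filter_upwards [lt_mem_nhds (show (-1 : ℝ) < 0 by norm_num)] with τ hτ
    rw [← hF.log_homogeneous x hx (1 + τ) (by linarith), add_smul, one_smul]
  simpa [-inner_gradient_left] using h1.unique (h2.congr_of_eventuallyEq h3)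

theorem hessOp_self (hF : IsLogHomogeneousBarrier F K ν) (hx : x ∈ interior K) :
    hessOp F x x = -gradient F x := by
  refine ext_inner_right ℝ fun v => ?_
  have h1 := hF.posDefSelfConcordantOn.hasDerivAt_inner_gradient (x := x) (h := x) (τ := 0)
    (by simpa using hx) v
  have h2 : HasDerivAt (fun τ : ℝ => (1 + τ)⁻¹ * ⟪gradient F x, v⟫) (-⟪gradient F x, v⟫) 0 := by
    have h3 := (((hasDerivAt_id (0 : ℝ)).const_add 1).inv (by simp)).mul_const ⟪gradient F x, v⟫
    simpa [-inner_gradient_left] using h3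
  have h3 : (fun τ : ℝ => ⟪gradient F (x + τ • x), v⟫) =ᶠ[nhds 0]
      fun τ => (1 + τ)⁻¹ * ⟪gradient F x, v⟫ := by
    filter_upwards [lt_mem_nhds (show (-1 : ℝ) < 0 by norm_num)] with τ hτ
    have hτ' : 0 < 1 + τ := by linarith
    rw [← hF.smul_gradient_smul hx hτ', real_inner_smul_left, add_smul, one_smul,
      inv_mul_cancel_left₀ hτ'.ne']
  have h4 := h1.unique (h2.congr_of_eventuallyEq h3)
  rw [inner_neg_left, ← h4, zero_smul, add_zero]

theorem localNorm_self (hF : IsLogHomogeneousBarrier F K ν) (hx : x ∈ interior K) :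
    localNorm F x x = √ν := by
  rw [localNorm, hF.hessOp_self hx, inner_neg_left, hF.inner_gradient_self hx, neg_neg]

theorem localNorm_le_of_mem_interior (hF : IsLogHomogeneousBarrier F K ν)
    (hx : x ∈ interior K) (hu : u ∈ interior K) :
    localNorm F x u ≤ -⟪gradient F x, u⟫ := by
  have hr0 := localNorm_nonneg F x u
  have hle : ∀ τ : ℝ, 1 ≤ τ → ⟪gradient F x, u⟫ + localNorm F x u ≤
      (F (u + τ⁻¹ • x) - F x + Real.log (1 + localNorm F x u)) / τ := by
    intro τ hτ
    have hτ0 : 0 < τ := by linarith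
    have h1 := hF.posDefSelfConcordantOn.add_log_le hx
      (hF.add_mem_interior hx (interior_subset (hF.smul_mem_interior hu hτ0)))
    have h2 : x + τ • u = τ • (u + τ⁻¹ • x) := by
      rw [smul_add, smul_inv_smul₀ hτ0.ne', add_comm]
    rw [localNorm_smul, abs_of_pos hτ0, real_inner_smul_right, h2,
      hF.log_homogeneous _ (hF.add_mem_interior hu (interior_subset
        (hF.smul_mem_interior hx (inv_pos.2 hτ0)))) τ hτ0] at h1
    have h3 : Real.log (1 + τ * localNorm F x u) ≤
        Real.log τ + Real.log (1 + localNorm F x u) := by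
      rw [← Real.log_mul hτ0.ne' (by positivity)]
      exact Real.log_le_log (by positivity) (by nlinarith)
    have h4 := mul_le_mul_of_nonneg_right hF.one_le (Real.log_nonneg hτ)
    rw [le_div_iff₀ hτ0]
    linarith
  have hlim : Filter.Tendsto
      (fun τ : ℝ => (F (u + τ⁻¹ • x) - F x + Real.log (1 + localNorm F x u)) / τ)
      Filter.atTop (nhds 0) := by
    refine Filter.Tendsto.div_atTop (a := F u - F x + Real.log (1 + localNorm F x u))
      ((Filter.Tendsto.sub_const ?_ _).add_const _) Filter.tendsto_id
    refine (hF.posDefSelfConcordantOn.contDiffAt hu).continuousAt.tendsto.comp ?_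
    simpa using ((tendsto_inv_atTop_zero (𝕜 := ℝ)).smul_const x).const_add u
  have h5 := ge_of_tendsto hlim
    ((Filter.eventually_ge_atTop (1 : ℝ)).mono fun τ hτ => hle τ hτ)
  linarith

theorem localNorm_le_of_mem (hF : IsLogHomogeneousBarrier F K ν) (hx : x ∈ interior K)
    (hu : u ∈ K) : localNorm F x u ≤ -⟪gradient F x, u⟫ := by
  have hc : Continuous fun ε : ℝ => localNorm F x (ε • x + u) := by
    unfold localNorm
    fun_prop
  have hc' : Continuous fun ε : ℝ => -⟪gradient F x, ε • x + u⟫ := by fun_prop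
  have h1 := (hc.tendsto 0).mono_left (nhdsWithin_le_nhds (s := Set.Ioi 0))
  have h2 := (hc'.tendsto 0).mono_left (nhdsWithin_le_nhds (s := Set.Ioi 0))
  have h3 := le_of_tendsto_of_tendsto h1 h2 (by
    filter_upwards [self_mem_nhdsWithin] with ε hε
    exact hF.localNorm_le_of_mem_interior hx
      (hF.add_mem_interior (hF.smul_mem_interior hx hε) hu))
  simpa [-inner_gradient_left] using h3

end IsLogHomogeneousBarrier

end Barrier

section Conjugate

variable {E : Type*} [NormedAddCommGroup E] [InnerProductSpace ℝ E] [CompleteSpace E]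

/-- A maximizing sequence of the conjugate at a point of differentiability converges to minus its
gradient. -/
theorem tendsto_neg_gradient_of_maximizing {F G : E → ℝ} {D S : Set E} {s : E}
    (hS : S ∈ nhds s) (hG : DifferentiableAt ℝ G s)
    (hle : ∀ s' ∈ S, ∀ x ∈ D, -⟪s', x⟫ - F x ≤ G s') {u : ℕ → E} (hu : ∀ n, u n ∈ D)
    (hlim : Filter.Tendsto (fun n => -⟪s, u n⟫ - F (u n)) Filter.atTop (nhds (G s))) :
    Filter.Tendsto u Filter.atTop (nhds (-gradient G s)) := by
  rw [tendsto_iff_norm_sub_tendsto_zero, Metric.tendsto_atTop]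
  intro ε hε
  have h1 := (hasFDerivAt_iff_isLittleO.1 hG.hasGradientAt.hasFDerivAt).def
    (show 0 < ε / 4 by positivity)
  obtain ⟨η, hη, hball⟩ := Metric.eventually_nhds_iff_ball.1 (h1.and hS)
  obtain ⟨N, hN⟩ := Metric.tendsto_atTop.1 hlim (η / 2 * (ε / 4)) (by positivity)
  refine ⟨N, fun n hn => ?_⟩
  rw [Real.dist_eq, sub_zero, abs_of_nonneg (norm_nonneg _)]
  set d := u n - -gradient G s with hd
  by_contra! hcon
  have hd0 : 0 < ‖d‖ := hε.trans_le hcon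
  set v := -(η / 2 / ‖d‖) • d with hv
  have hvn : ‖v‖ = η / 2 := by
    rw [hv, norm_smul, norm_neg, Real.norm_of_nonneg (by positivity)]
    field_simp
  obtain ⟨h2, h3⟩ := hball (s + v) (by
    rw [mem_ball_iff_norm, add_sub_cancel_left, hvn]; linarith)
  have h4 := hle _ h3 _ (hu n)
  have h5 := (abs_lt.1 (hN n hn)).1
  rw [add_sub_cancel_left, hvn] at h2
  have h6 := (abs_le.1 h2).2
  have h7 : ⟪v, d⟫ = -(η / 2 * ‖d‖) := by
    rw [hv, real_inner_smul_left, real_inner_self_eq_norm_sq]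
    field_simp
  have h8 : ⟪v, d⟫ = ⟪v, u n⟫ + ⟪gradient G s, v⟫ := by
    rw [hd, sub_neg_eq_add, inner_add_right, real_inner_comm v]
  rw [InnerProductSpace.toDual_apply_apply] at h6
  rw [inner_add_left] at h4
  nlinarith

/-- `Fstar` is the conjugate barrier of `F`. -/
structure IsConjugateBarrier (F Fstar : E → ℝ) (K : Set E) : Prop where
  isLUB : ∀ s ∈ interior (dualCone K),
    IsLUB {v : ℝ | ∃ x ∈ interior K, v = -⟪s, x⟫ - F x} (Fstar s)
  posDefSelfConcordantOn : PosDefSelfConcordantOn Fstar (interior (dualCone K))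

namespace IsConjugateBarrier

variable {F Fstar : E → ℝ} {K : Set E} {ν : ℝ} {s : E}

theorem neg_gradient_mem_and_gradient_neg_gradient (hF : IsLogHomogeneousBarrier F K ν)
    (hG : IsConjugateBarrier F Fstar K) (hne : (interior K).Nonempty)
    (hs : s ∈ interior (dualCone K)) :
    -gradient Fstar s ∈ interior K ∧ gradient F (-gradient Fstar s) = -s := by
  have hle : ∀ s' ∈ interior (dualCone K), ∀ x ∈ interior K, -⟪s', x⟫ - F x ≤ Fstar s' :=
    fun s' hs' x hx => (hG.isLUB s' hs').1 ⟨x, hx, rfl⟩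
  obtain ⟨x₀, hx₀⟩ := hne
  obtain ⟨v, -, -, hvlim, hv⟩ := (hG.isLUB s hs).exists_seq_monotone_tendsto ⟨_, x₀, hx₀, rfl⟩
  choose u hu huv using hv
  have hvlim' : Filter.Tendsto (fun n => -⟪s, u n⟫ - F (u n)) Filter.atTop
      (nhds (Fstar s)) := by
    simpa only [← huv] using hvlim
  have hulim := tendsto_neg_gradient_of_maximizing (isOpen_interior.mem_nhds hs)
    ((hG.posDefSelfConcordantOn.contDiffAt hs).differentiableAt (by norm_num)) hle hu hvlim'
  set x := -gradient Fstar s with hx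
  have hinner : Filter.Tendsto (fun n => ⟪s, u n⟫) Filter.atTop (nhds ⟪s, x⟫) :=
    tendsto_const_nhds.inner hulim
  have hFlim : Filter.Tendsto (fun n => F (u n)) Filter.atTop (nhds (-⟪s, x⟫ - Fstar s)) := by
    simpa using hinner.neg.sub hvlim'
  have hxK : x ∈ interior K := by
    by_contra hcon
    have hfr : x ∈ frontier K := by
      rw [hF.isClosed.frontier_eq]
      exact ⟨hF.isClosed.mem_of_tendsto hulim (Filter.Eventually.of_forall fun n =>
        interior_subset (hu n)), hcon⟩
    exact not_tendsto_atTop_of_tendsto_nhds hFlim (hF.blowsUpAtFrontier x hfr u hu hulim)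
  refine ⟨hxK, ?_⟩
  have hd := hF.posDefSelfConcordantOn.contDiffAt hxK
  have hFx : F x = -⟪s, x⟫ - Fstar s :=
    tendsto_nhds_unique (hd.continuousAt.tendsto.comp hulim) hFlim
  have hmin : IsLocalMin (fun y => ⟪s, y⟫ + F y) x := by
    filter_upwards [isOpen_interior.mem_nhds hxK] with y hy
    linarith [hle s hs y hy]
  have hder := (innerSL ℝ s).hasFDerivAt.add hd.hasGradientAt'.hasFDerivAt (x := x)
  have h0 := hmin.hasFDerivAt_eq_zero hder
  refine ext_inner_right ℝ fun w => ?_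
  have h1 := congrArg (fun l => l w) h0
  simp only [add_apply, innerSL_apply_apply, InnerProductSpace.toDual_apply_apply,
    zero_apply] at h1
  rw [inner_neg_left]
  linarith

theorem hessOp_hessOp (hF : IsLogHomogeneousBarrier F K ν)
    (hG : IsConjugateBarrier F Fstar K) (hne : (interior K).Nonempty)
    (hs : s ∈ interior (dualCone K)) (v : E) :
    hessOp F (-gradient Fstar s) (hessOp Fstar s v) = v := by
  obtain ⟨hx, -⟩ := neg_gradient_mem_and_gradient_neg_gradient hF hG hne hs
  have h1 := (hF.posDefSelfConcordantOn.contDiffAt hx).hasFDerivAt_gradient.comp s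
    (hG.posDefSelfConcordantOn.contDiffAt hs).hasFDerivAt_gradient.neg
  have h2 : (gradient F ∘ fun s => -gradient Fstar s) =ᶠ[nhds s] fun s => -s := by
    filter_upwards [isOpen_interior.mem_nhds hs] with s' hs'
    exact (neg_gradient_mem_and_gradient_neg_gradient hF hG hne hs').2
  have h3 := h1.unique ((hasFDerivAt_id s).neg.congr_of_eventuallyEq h2)
  simpa using congrArg (fun l => l v) h3

theorem hessOp_hessOp' (hF : IsLogHomogeneousBarrier F K ν)
    (hG : IsConjugateBarrier F Fstar K) (hne : (interior K).Nonempty)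
    (hs : s ∈ interior (dualCone K)) (v : E) :
    hessOp Fstar s (hessOp F (-gradient Fstar s) v) = v := by
  obtain ⟨hx, -⟩ := neg_gradient_mem_and_gradient_neg_gradient hF hG hne hs
  have h1 := hessOp_hessOp hF hG hne hs (hessOp F (-gradient Fstar s) v)
  by_contra hcon
  have h2 := hF.posDefSelfConcordantOn.hessOp_pos _ hx _ (sub_ne_zero.2 hcon)
  rw [map_sub, h1, sub_self, inner_zero_left] at h2
  exact h2.false

theorem inner_le_localNorm_mul_localNorm (hF : IsLogHomogeneousBarrier F K ν)
    (hG : IsConjugateBarrier F Fstar K) (hne : (interior K).Nonempty)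
    (hs : s ∈ interior (dualCone K)) (v u : E) :
    -(localNorm Fstar s v * localNorm F (-gradient Fstar s) u) ≤ ⟪v, u⟫ := by
  obtain ⟨hx, -⟩ := neg_gradient_mem_and_gradient_neg_gradient hF hG hne hs
  set x := -gradient Fstar s with hxs
  set w := hessOp Fstar s v with hw
  have hwv : hessOp F x w = v := hessOp_hessOp hF hG hne hs v
  have hnorm : localNorm F x w = localNorm Fstar s v := by
    rw [localNorm, localNorm, hwv, real_inner_comm]
  have h1 := hF.posDefSelfConcordantOn.inner_hessOp_le hx w (-u)
  have h2 : localNorm F x (-u) = localNorm F x u := by simp [localNorm]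
  rw [hwv, hnorm, h2, inner_neg_right] at h1
  linarith

/-- The Dikin ellipsoid of the conjugate barrier lies in the interior of the dual cone. -/
theorem add_mem_interior_dualCone (hF : IsLogHomogeneousBarrier F K ν)
    (hG : IsConjugateBarrier F Fstar K) (hne : (interior K).Nonempty)
    (hs : s ∈ interior (dualCone K)) {v : E} (hv : localNorm Fstar s v < 1) :
    s + v ∈ interior (dualCone K) := by
  obtain ⟨hx, hgrad⟩ := neg_gradient_mem_and_gradient_neg_gradient hF hG hne hs
  have hc : Continuous fun s' : E => localNorm Fstar s (s' - s) := by
    unfold localNorm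
    fun_prop
  refine mem_interior.2 ⟨{s' | localNorm Fstar s (s' - s) < 1}, fun s' hs' u hu => ?_,
    isOpen_lt hc continuous_const, by simpa using hv⟩
  have h1 := hF.localNorm_le_of_mem hx hu
  have h2 := inner_le_localNorm_mul_localNorm hF hG hne hs (s' - s) u
  rw [hgrad, inner_neg_left, neg_neg] at h1
  rw [inner_sub_left] at h2
  have h3 := mul_le_mul_of_nonneg_right (le_of_lt hs') (localNorm_nonneg F (-gradient Fstar s) u)
  linarith

end IsConjugateBarrier

end Conjugate

section OmegaStar

theorem omegaStar_nonneg {τ : ℝ} (hτ : τ < 1) : 0 ≤ omegaStar τ := by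
  have := Real.log_le_sub_one_of_pos (show 0 < 1 - τ by linarith)
  rw [omegaStar]
  linarith

theorem hasSum_omegaStar {τ : ℝ} (hτ : |τ| < 1) :
    HasSum (fun n : ℕ => τ ^ (n + 2) / ((n : ℝ) + 2)) (omegaStar τ) := by
  have h1 := (hasSum_nat_add_iff' 1).2 (Real.hasSum_pow_div_log_of_abs_lt_one hτ)
  have h2 : omegaStar τ = -Real.log (1 - τ) -
      ∑ i ∈ Finset.range 1, τ ^ (i + 1) / ((i : ℝ) + 1) := by
    simp [omegaStar]
    ring
  have h3 : (fun n : ℕ => τ ^ (n + 2) / ((n : ℝ) + 2)) =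
      fun n : ℕ => τ ^ (n + 1 + 1) / (((n + 1 : ℕ) : ℝ) + 1) := by
    funext n
    push_cast
    ring_nf
  rw [h2, h3]
  exact h1

theorem omegaStar_add_omegaStar_le {a b c : ℝ} (ha : 0 ≤ a) (hb : 0 ≤ b) (hc : 0 ≤ c)
    (hc1 : c < 1) (h : a ^ 2 + b ^ 2 ≤ c ^ 2) : omegaStar a + omegaStar b ≤ omegaStar c := by
  have hac : a ≤ c := abs_le_of_sq_le_sq' (by nlinarith) hc |>.2
  have hbc : b ≤ c := abs_le_of_sq_le_sq' (by nlinarith) hc |>.2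
  refine hasSum_le (fun n => ?_)
    ((hasSum_omegaStar (by rw [abs_of_nonneg ha]; linarith)).add
      (hasSum_omegaStar (by rw [abs_of_nonneg hb]; linarith)))
    (hasSum_omegaStar (by rwa [abs_of_nonneg hc]))
  rw [← add_div]
  gcongr
  calc a ^ (n + 2) + b ^ (n + 2) = a ^ n * a ^ 2 + b ^ n * b ^ 2 := by ring
    _ ≤ c ^ n * a ^ 2 + c ^ n * b ^ 2 := by gcongr
    _ = c ^ n * (a ^ 2 + b ^ 2) := by ring
    _ ≤ c ^ n * c ^ 2 := by gcongr
    _ = c ^ (n + 2) := by ring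

end OmegaStar

section AffineScaling

variable {E : Type*} [NormedAddCommGroup E] [InnerProductSpace ℝ E] [CompleteSpace E]
  {F Fstar : E → ℝ} {K : Set E} {ν : ℝ}

theorem IsConjugateBarrier.inner_gradient_self (hF : IsLogHomogeneousBarrier F K ν)
    (hG : IsConjugateBarrier F Fstar K) (hne : (interior K).Nonempty) {s : E}
    (hs : s ∈ interior (dualCone K)) : ⟪gradient Fstar s, s⟫ = -ν := by
  obtain ⟨hx, hgrad⟩ := hG.neg_gradient_mem_and_gradient_neg_gradient hF hne hs
  have h1 := hF.inner_gradient_self hx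
  rwa [hgrad, inner_neg_neg, real_inner_comm] at h1

/-- A primal-dual scaling pair: `xb = -(1 / t) ∇F*(sb)` and `wb = √t xb`. -/
structure IsScalingPoint (F Fstar : E → ℝ) (K : Set E) (t : ℝ) (xb sb wb : E) : Prop where
  pos : 0 < t
  mem : xb ∈ interior K
  mem_dual : sb ∈ interior (dualCone K)
  eq_gradient : xb = -(1 / t) • gradient Fstar sb
  eq_smul : wb = √t • xb

namespace IsScalingPoint

variable {t : ℝ} {xb sb wb : E}

theorem gradient_conj (h : IsScalingPoint F Fstar K t xb sb wb) :
    gradient Fstar sb = -(t • xb) := by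
  rw [h.eq_gradient, smul_smul, ← neg_smul]
  have := h.pos.ne'
  field_simp
  simp

theorem smul_hessOp (hF : IsLogHomogeneousBarrier F K ν)
    (h : IsScalingPoint F Fstar K t xb sb wb) (u : E) :
    t • hessOp F wb u = hessOp F xb u := by
  have h1 := hF.sq_smul_hessOp_smul h.mem (Real.sqrt_pos.2 h.pos)
  rw [Real.sq_sqrt h.pos.le, ← h.eq_smul] at h1
  rw [← h1, smul_apply]

theorem hessOp_conj_hessOp (hF : IsLogHomogeneousBarrier F K ν)
    (hG : IsConjugateBarrier F Fstar K) (h : IsScalingPoint F Fstar K t xb sb wb) (u : E) :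
    hessOp Fstar sb (hessOp F wb u) = t • u := by
  have ht := h.pos.ne'
  have h1 := hG.hessOp_hessOp' hF ⟨xb, h.mem⟩ h.mem_dual u
  rw [h.gradient_conj, neg_neg] at h1
  have h2 := hF.sq_smul_hessOp_smul h.mem h.pos
  have h3 : hessOp F wb u = t • hessOp F (t • xb) u := by
    apply smul_right_injective E ht
    simp only
    rw [h.smul_hessOp hF, ← h2, smul_apply, smul_smul, sq]
  rw [h3, map_smul, h1]

theorem gradient_eq (hF : IsLogHomogeneousBarrier F K ν)
    (hG : IsConjugateBarrier F Fstar K) (h : IsScalingPoint F Fstar K t xb sb wb) :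
    gradient F xb = -(t • sb) := by
  have h1 := (hG.neg_gradient_mem_and_gradient_neg_gradient hF ⟨xb, h.mem⟩ h.mem_dual).2
  rw [h.gradient_conj, neg_neg] at h1
  rw [← hF.smul_gradient_smul h.mem h.pos, h1, smul_neg]

theorem hessOp_self (hF : IsLogHomogeneousBarrier F K ν)
    (hG : IsConjugateBarrier F Fstar K) (h : IsScalingPoint F Fstar K t xb sb wb) :
    hessOp F wb xb = sb := by
  apply smul_right_injective E h.pos.ne'
  simp only
  rw [h.smul_hessOp hF, hF.hessOp_self h.mem, h.gradient_eq hF hG, neg_neg]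

theorem localNorm_conj_hessOp (hF : IsLogHomogeneousBarrier F K ν)
    (hG : IsConjugateBarrier F Fstar K) (h : IsScalingPoint F Fstar K t xb sb wb) (u : E) :
    localNorm Fstar sb (hessOp F wb u) = localNorm F xb u := by
  rw [localNorm, localNorm, h.hessOp_conj_hessOp hF hG, ← h.smul_hessOp hF,
    real_inner_smul_left, real_inner_smul_left, real_inner_comm]

variable {xh sh dx ds : E} {β : ℝ}

theorem sub_eq_hessOp (hF : IsLogHomogeneousBarrier F K ν)
    (hG : IsConjugateBarrier F Fstar K) (h : IsScalingPoint F Fstar K t xb sb wb)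
    (hscale : sh = hessOp F wb xh) : sh - sb = hessOp F wb (xh - xb) := by
  rw [map_sub, ← hscale, h.hessOp_self hF hG]

theorem localNorm_le_sqrt_add (hF : IsLogHomogeneousBarrier F K ν)
    (h : IsScalingPoint F Fstar K t xb sb wb) (hclose : localNorm F xb (xh - xb) ≤ β) :
    localNorm F xb xh ≤ √ν + β := by
  have h1 := hF.posDefSelfConcordantOn.localNorm_add_le h.mem xb (xh - xb)
  rw [add_sub_cancel, hF.localNorm_self h.mem] at h1
  linarith

theorem inner_hessOp_eq_zero (hF : IsLogHomogeneousBarrier F K ν)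
    (h : IsScalingPoint F Fstar K t xb sb wb) (hds : ds = -hessOp F wb (xh + dx))
    (horth : ⟪ds, dx⟫ = 0) : ⟪hessOp F xb (xh + dx), dx⟫ = 0 := by
  rw [← h.smul_hessOp hF, ← neg_neg (hessOp F wb (xh + dx)), ← hds, real_inner_smul_left,
    inner_neg_left, horth, neg_zero, mul_zero]

/-- The primal and dual parts of the affine-scaling direction split the local norm of the
current point orthogonally. -/
theorem sq_localNorm_add_sq_localNorm (hF : IsLogHomogeneousBarrier F K ν)
    (h : IsScalingPoint F Fstar K t xb sb wb) (hds : ds = -hessOp F wb (xh + dx))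
    (horth : ⟪ds, dx⟫ = 0) :
    localNorm F xb dx ^ 2 + localNorm F xb (xh + dx) ^ 2 = localNorm F xb xh ^ 2 := by
  have hF' := hF.posDefSelfConcordantOn
  have h1 := h.inner_hessOp_eq_zero hF hds horth
  have h2 := (hF'.contDiffAt h.mem).inner_hessOp_comm dx xh
  rw [hF'.sq_localNorm h.mem, hF'.sq_localNorm h.mem, hF'.sq_localNorm h.mem]
  simp only [map_add, inner_add_left, inner_add_right] at h1 ⊢
  linarith

theorem localNorm_add_add_eq (hF : IsLogHomogeneousBarrier F K ν)
    (h : IsScalingPoint F Fstar K t xb sb wb) (hds : ds = -hessOp F wb (xh + dx))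
    (horth : ⟪ds, dx⟫ = 0) : localNorm F xb (xh + dx + dx) = localNorm F xb xh := by
  have hF' := hF.posDefSelfConcordantOn
  have h1 := h.inner_hessOp_eq_zero hF hds horth
  have h2 := (hF'.contDiffAt h.mem).inner_hessOp_comm dx xh
  rw [localNorm, localNorm]
  congr 1
  simp only [map_add, inner_add_left, inner_add_right] at h1 ⊢
  linarith

theorem sq_add_sq_localNorm_le (hF : IsLogHomogeneousBarrier F K ν)
    (hG : IsConjugateBarrier F Fstar K) (h : IsScalingPoint F Fstar K t xb sb wb)
    (hβ : β < 1) (hxh : xh ∈ interior K) (hsh : sh ∈ interior (dualCone K))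
    (hscale : sh = hessOp F wb xh) (hclose : localNorm F xb (xh - xb) ≤ β)
    (hds : ds = -hessOp F wb (xh + dx)) (horth : ⟪ds, dx⟫ = 0) :
    localNorm F xh dx ^ 2 + localNorm Fstar sh ds ^ 2 ≤ ((√ν + β) / (1 - β)) ^ 2 := by
  have hsub := h.sub_eq_hessOp hF hG hscale
  have hr : localNorm Fstar sb (sh - sb) = localNorm F xb (xh - xb) := by
    rw [hsub, h.localNorm_conj_hessOp hF hG]
  have h1 := hF.posDefSelfConcordantOn.localNorm_add_point_le (h := xh - xb) h.mem
    (by simpa using hxh) (by linarith) dx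
  have h2 := hG.posDefSelfConcordantOn.localNorm_add_point_le (h := sh - sb) h.mem_dual
    (by simpa using hsh) (by linarith) ds
  have h3 : localNorm Fstar sb ds = localNorm F xb (xh + dx) := by
    rw [hds, ← map_neg, h.localNorm_conj_hessOp hF hG, ← neg_one_smul ℝ, localNorm_smul]
    simp
  rw [add_sub_cancel] at h1 h2
  rw [hr, h3] at h2
  have h4 := h.sq_localNorm_add_sq_localNorm hF hds horth
  have h5 := h.localNorm_le_sqrt_add hF hclose
  have n1 := localNorm_nonneg F xb dx
  have n2 := localNorm_nonneg F xb (xh + dx)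
  have hβ' : 0 < 1 - β := by linarith
  have h1' := h1.trans (div_le_div_of_nonneg_left n1 hβ' (by linarith))
  have h2' := h2.trans (div_le_div_of_nonneg_left n2 hβ' (by linarith))
  calc _ ≤ (localNorm F xb dx / (1 - β)) ^ 2 + (localNorm F xb (xh + dx) / (1 - β)) ^ 2 :=
        add_le_add (pow_le_pow_left₀ (localNorm_nonneg _ _ _) h1' 2)
          (pow_le_pow_left₀ (localNorm_nonneg _ _ _) h2' 2)
    _ = localNorm F xb xh ^ 2 / (1 - β) ^ 2 := by rw [div_pow, div_pow, ← add_div, h4]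
    _ ≤ (√ν + β) ^ 2 / (1 - β) ^ 2 := by
        gcongr
        exact localNorm_nonneg _ _ _
    _ = _ := (div_pow _ _ _).symm

/-- The first-order change of `F(x) + F*(s)` along the affine-scaling direction. -/
theorem inner_gradient_add_inner_gradient_le (hF : IsLogHomogeneousBarrier F K ν)
    (hG : IsConjugateBarrier F Fstar K) (h : IsScalingPoint F Fstar K t xb sb wb)
    (hβ : β < 1) (hxh : xh ∈ interior K) (hsh : sh ∈ interior (dualCone K))
    (hscale : sh = hessOp F wb xh) (hclose : localNorm F xb (xh - xb) ≤ β)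
    (hds : ds = -hessOp F wb (xh + dx)) (horth : ⟪ds, dx⟫ = 0) :
    ⟪gradient F xh, dx⟫ + ⟪gradient Fstar sh, ds⟫ ≤ ν + (√ν + β) / (1 - β) * β ^ 2 := by
  have hsub := h.sub_eq_hessOp hF hG hscale
  have hr : localNorm Fstar sb (sh - sb) = localNorm F xb (xh - xb) := by
    rw [hsub, h.localNorm_conj_hessOp hF hG]
  set z := xh + dx + dx with hz
  have hz' : -hessOp F wb z = sh + ds + ds := by
    rw [hz, hds, hscale]
    simp only [map_add]
    abel
  have h1 := hF.posDefSelfConcordantOn.inner_gradient_sub_le (h := xh - xb) h.mem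
    (by simpa using hxh) (by linarith) z
  have h2 := hG.posDefSelfConcordantOn.inner_gradient_sub_le (h := sh - sb) h.mem_dual
    (by simpa using hsh) (by linarith) (-hessOp F wb z)
  have h3 : localNorm Fstar sb (-hessOp F wb z) = localNorm F xb z := by
    rw [← map_neg, h.localNorm_conj_hessOp hF hG, ← neg_one_smul ℝ, localNorm_smul]
    simp
  have hcancel : ⟪gradient F xb + hessOp F xb (xh - xb), z⟫ +
      ⟪gradient Fstar sb + hessOp Fstar sb (sh - sb), -hessOp F wb z⟫ = 0 := by
    have h4 : gradient F xb = -hessOp F xb xb := by rw [hF.hessOp_self h.mem, neg_neg]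
    rw [h4, h.gradient_conj, hsub, h.hessOp_conj_hessOp hF hG, ← smul_neg, ← smul_add,
      real_inner_smul_left, ← real_inner_smul_right, smul_neg, h.smul_hessOp hF, inner_neg_right,
      real_inner_comm, ← map_neg, ← map_add]
    have h5 := (hF.posDefSelfConcordantOn.contDiffAt h.mem).inner_hessOp_comm z
      (-xb + (xh - xb))
    rw [real_inner_comm, real_inner_comm z] at h5
    linarith
  rw [add_sub_cancel] at h1 h2
  rw [hr, h3] at h2
  have h4 := h.localNorm_add_add_eq hF hds horth
  rw [← hz] at h4
  have h5 := h.localNorm_le_sqrt_add hF hclose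
  have h6 := hF.inner_gradient_self hxh
  have h7 := hG.inner_gradient_self hF ⟨xb, h.mem⟩ hsh
  have h8 : ⟪gradient F xh, z⟫ = -ν + 2 * ⟪gradient F xh, dx⟫ := by
    rw [hz, inner_add_right, inner_add_right, h6]
    ring
  have h9 : ⟪gradient Fstar sh, -hessOp F wb z⟫ = -ν + 2 * ⟪gradient Fstar sh, ds⟫ := by
    rw [hz', inner_add_right, inner_add_right, h7]
    ring
  rw [sub_sub, inner_sub_left, h8] at h1
  rw [sub_sub, inner_sub_left, h9] at h2
  rw [h4] at h1 h2
  have n1 := localNorm_nonneg F xb (xh - xb)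
  have hβ' : 0 < 1 - β := by linarith
  have h10 : localNorm F xb (xh - xb) ^ 2 / (1 - localNorm F xb (xh - xb)) *
      localNorm F xb xh ≤ β ^ 2 / (1 - β) * (√ν + β) := by
    gcongr
    exact localNorm_nonneg _ _ _
  have h11 : β ^ 2 / (1 - β) * (√ν + β) = (√ν + β) / (1 - β) * β ^ 2 := by ring
  linarith

end IsScalingPoint

end AffineScaling

/-- Theorem 5.1 of the paper. For a proper cone `K` with a
`ν`-logarithmically homogeneous self-concordant barrier `F` and conjugate barrier `F*`, for
the point `(x̂, ŷ, ŝ)` produced by the Dual Gambit Rule (formalized by its characteristic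
properties: feasibility, the scaling relation `ŝ = ∇²F(w̄) x̂` with `w̄ = √t x̄`,
`x̄ = -(1/t)∇F*(s̄)`, and the closeness bounds `‖x̂-x̄‖_{x̄} ≤ β`, `‖ŝ-s̄‖_{s̄} ≤ β`), and for
the affine-scaling direction `(Δx, Δy, Δs)`, every `α ∈ [0,1)` with `α c_β < 1`
(`c_β = (√ν + β)/(1-β)`) keeps the point in the interiors of the cones and the functional
proximity measure grows at most as
`Ω(x̂+αΔx, ŝ+αΔs) ≤ Ω(x̂,ŝ) + α c_β β² + ω_*(α c_β) - ν ω_*(α) ≤ Ω(x̂,ŝ) - ln(1 - α c_β)`. -/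
theorem stmt10 {E : Type*} [NormedAddCommGroup E] [InnerProductSpace ℝ E]
    [FiniteDimensional ℝ E] {m : ℕ}
    (K : Set E) (hKclosed : IsClosed K) (hKconv : Convex ℝ K)
    (hKcone : ∀ x ∈ K, ∀ τ : ℝ, 0 < τ → τ • x ∈ K)
    (hKpointed : K ∩ (-K) ⊆ {0})
    (hKint : (interior K).Nonempty)
    (F : E → ℝ) (ν : ℝ) (hν : 1 ≤ ν)
    (hFsc : SelfConcordantOn F (interior K))
    (hFpos : ∀ x ∈ interior K, ∀ u : E, u ≠ 0 → 0 < ⟪hessOp F x u, u⟫)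
    (hFhom : ∀ x ∈ interior K, ∀ τ : ℝ, 0 < τ → F (τ • x) = F x - ν * Real.log τ)
    (hFbar : ∀ z ∈ frontier K, ∀ u : ℕ → E, (∀ i, u i ∈ interior K) →
      Filter.Tendsto u Filter.atTop (nhds z) →
      Filter.Tendsto (fun i => F (u i)) Filter.atTop Filter.atTop)
    (Fstar : E → ℝ)
    (hconj : ∀ s ∈ interior (dualCone K),
      IsLUB {v : ℝ | ∃ x ∈ interior K, v = -⟪s, x⟫ - F x} (Fstar s))
    (hFssc : SelfConcordantOn Fstar (interior (dualCone K)))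
    (hFspos : ∀ s ∈ interior (dualCone K), ∀ u : E, u ≠ 0 → 0 < ⟪hessOp Fstar s u, u⟫)
    (A : E →ₗ[ℝ] EuclideanSpace ℝ (Fin m)) (b : EuclideanSpace ℝ (Fin m)) (c : E)
    (β t : ℝ) (hβ : β ∈ Set.Ioo (0 : ℝ) 1) (ht : 0 < t)
    (sb : E) (hsb : sb ∈ interior (dualCone K))
    (xb : E) (hxb : xb = -(1 / t) • gradient Fstar sb) (hxbK : xb ∈ interior K)
    (wb : E) (hwb : wb = Real.sqrt t • xb)
    (xh : E) (hxhK : xh ∈ interior K)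
    (yh : EuclideanSpace ℝ (Fin m))
    (sh : E) (hshK : sh ∈ interior (dualCone K))
    (hfeas1 : A xh = b) (hfeas2 : sh + LinearMap.adjoint A yh = c)
    (hscale : sh = hessOp F wb xh)
    (hclose1 : Real.sqrt ⟪hessOp F xb (xh - xb), xh - xb⟫ ≤ β)
    (hclose2 : Real.sqrt ⟪hessOp Fstar sb (sh - sb), sh - sb⟫ ≤ β)
    (dx ds : E) (dy : EuclideanSpace ℝ (Fin m))
    (hdir1 : ds + hessOp F wb dx = -sh) (hdir2 : A dx = 0)
    (hdir3 : ds + LinearMap.adjoint A dy = 0)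
    (α : ℝ) (hα0 : 0 ≤ α) (hα1 : α < 1)
    (hαc : α * ((Real.sqrt ν + β) / (1 - β)) < 1) :
    xh + α • dx ∈ interior K ∧
    sh + α • ds ∈ interior (dualCone K) ∧
    proxOmega F Fstar ν (xh + α • dx) (sh + α • ds)
      ≤ proxOmega F Fstar ν xh sh + α * ((Real.sqrt ν + β) / (1 - β)) * β ^ 2
        + omegaStar (α * ((Real.sqrt ν + β) / (1 - β))) - ν * omegaStar α ∧
    proxOmega F Fstar ν xh sh + α * ((Real.sqrt ν + β) / (1 - β)) * β ^ 2
        + omegaStar (α * ((Real.sqrt ν + β) / (1 - β))) - ν * omegaStar α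
      ≤ proxOmega F Fstar ν xh sh
        - Real.log (1 - α * ((Real.sqrt ν + β) / (1 - β))) := by
  have hF : IsLogHomogeneousBarrier F K ν :=
    ⟨hKclosed, hKconv, hKcone, hν, ⟨hFsc, hFpos⟩, hFhom, hFbar⟩
  have hG : IsConjugateBarrier F Fstar K := ⟨hconj, hFssc, hFspos⟩
  have hP : IsScalingPoint F Fstar K t xb sb wb := ⟨ht, hxbK, hsb, hxb, hwb⟩
  have hds : ds = -hessOp F wb (xh + dx) := by
    rw [map_add, ← hscale, eq_sub_of_add_eq hdir1]
    abel
  have horth : ⟪ds, dx⟫ = 0 := by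
    rw [eq_neg_of_add_eq_zero_left hdir3, inner_neg_left, LinearMap.adjoint_inner_left, hdir2,
      inner_zero_right, neg_zero]
  have hsq := hP.sq_add_sq_localNorm_le hF hG hβ.2 hxhK hshK hscale hclose1 hds horth
  have hlin := hP.inner_gradient_add_inner_gradient_le hF hG hβ.2 hxhK hshK hscale hclose1 hds
    horth
  have hβ0 : 0 < β := hβ.1
  have hβ1 : 0 < 1 - β := by linarith [hβ.2]
  have hc0 : 0 ≤ (√ν + β) / (1 - β) := by positivity
  set cβ := (√ν + β) / (1 - β) with hcβ
  have hαc0 : 0 ≤ α * cβ := mul_nonneg hα0 hc0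
  have hnx : localNorm F xh (α • dx) = α * localNorm F xh dx := by
    rw [localNorm_smul, abs_of_nonneg hα0]
  have hns : localNorm Fstar sh (α • ds) = α * localNorm Fstar sh ds := by
    rw [localNorm_smul, abs_of_nonneg hα0]
  have hx0 := localNorm_nonneg F xh (α • dx)
  have hs0 := localNorm_nonneg Fstar sh (α • ds)
  have hsqα : localNorm F xh (α • dx) ^ 2 + localNorm Fstar sh (α • ds) ^ 2 ≤
      (α * cβ) ^ 2 := by
    rw [hnx, hns]
    nlinarith [mul_le_mul_of_nonneg_left hsq (sq_nonneg α)]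
  have hx1 : localNorm F xh (α • dx) < 1 := by nlinarith
  have hs1 : localNorm Fstar sh (α • ds) < 1 := by nlinarith
  have hxmem := hF.posDefSelfConcordantOn.add_mem_interior_of_localNorm_lt_one hKclosed hFbar
    hxhK hx1
  have hsmem := hG.add_mem_interior_dualCone hF hKint hshK hs1
  have hω := omegaStar_nonneg hα1
  refine ⟨hxmem, hsmem, ?_, ?_⟩
  · have h1 := hF.posDefSelfConcordantOn.le_add_omegaStar hxhK hxmem hx1
    have h2 := hG.posDefSelfConcordantOn.le_add_omegaStar hshK hsmem hs1
    have h3 := omegaStar_add_omegaStar_le hx0 hs0 hαc0 hαc hsqα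
    have hwbK : wb ∈ interior K := by
      rw [hwb]
      exact hF.smul_mem_interior hxbK (Real.sqrt_pos.2 ht)
    have hxh0 : xh ≠ 0 := by
      intro h0
      have h4 := hF.inner_gradient_self hxhK
      rw [h0, inner_zero_right] at h4
      linarith
    have hpos : 0 < ⟪sh, xh⟫ := hscale ▸ hFpos wb hwbK xh hxh0
    have hinner : ⟪sh + α • ds, xh + α • dx⟫ = (1 - α) * ⟪sh, xh⟫ := by
      have h4 : ⟪ds, xh⟫ + ⟪sh, dx⟫ = -⟪sh, xh⟫ := by
        have h5 : ⟪sh, dx⟫ = ⟪hessOp F wb dx, xh⟫ := by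
          rw [hscale]
          exact (hF.posDefSelfConcordantOn.contDiffAt hwbK).inner_hessOp_comm xh dx
        rw [h5, ← inner_add_left, hdir1, inner_neg_left]
      simp only [inner_add_left, inner_add_right, real_inner_smul_left, real_inner_smul_right,
        horth]
      linear_combination α * h4
    have hlog : Real.log ⟪sh + α • ds, xh + α • dx⟫ = Real.log (1 - α) + Real.log ⟪sh, xh⟫ := by
      rw [hinner, Real.log_mul (by linarith) hpos.ne']
    have h4 := mul_le_mul_of_nonneg_left hlin hα0
    rw [real_inner_smul_right] at h1 h2
    have h5 : ν * omegaStar α = -(ν * α) - ν * Real.log (1 - α) := by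
      rw [omegaStar]
      ring
    rw [proxOmega, proxOmega, hlog, h5]
    linarith
  · have h1 : α * cβ * β ^ 2 ≤ α * cβ := by
      refine mul_le_of_le_one_right hαc0 ?_
      nlinarith [hβ.2]
    have h2 := mul_nonneg (show 0 ≤ ν by linarith) hω
    have h3 : omegaStar (α * cβ) = -(α * cβ) - Real.log (1 - α * cβ) := rfl
    rw [h3]
    linarith
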